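/- Fix e ∈ S^n ⊂ ℝ^{n+1} and identify e^⊥ with ℝ^n. Let n+1 ≤ k ≤ 2n², let u_1,…,u_k ∈ S^{n−1} ⊂ e^⊥ and c_1,…,c_k > 0 satisfy Σ_{i=1}^k c_i u_i⊗u_i = Id_n and Σ_{i=1}^k c_i u_i = 0, and set ũ_i = √(n/(n+1)) u_i + (1/√(n+1)) e and c̃_i = ((n+1)/n) c_i. Let s ∈ [0, 0.15] and ε ∈ (0, n^{−56n}). If either ∫_{ℝ^{n+1}} Π_{i=1}^k g_s(⟨x, ũ_i⟩)^{c̃_i} dx ≥ 1 − ε, or the upper integral ∫*_{ℝ^{n+1}} sup{ Π_{i=1}^k g_s(θ_i)^{c̃_i} : θ_1,…,θ_k ∈ ℝ, x = Σ_{i=1}^k c̃_i θ_i ũ_i } dx ≤ 1 + ε, then there exist unit vectors w_1,…,w_{n+1} ∈ S^{n−1} forming the vertices of a regular simplex (pairwise inner products −1/n) and indices i_1 < … < i_{n+1} in {1,…,k} such that ∠(u_{i_j}, w_j) < n^{14n}·ε^{1/4} for j = 1,…,n+1. -/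

import Mathlib

open MeasureTheory Metric Set
open scoped RealInnerProductSpace ENNReal

noncomputable section

/-- The standard Gaussian density `g(t) = (2π)^{-1/2} e^{-t²/2}`. -/
def stdGauss (t : ℝ) : ℝ := (Real.sqrt (2 * Real.pi))⁻¹ * Real.exp (-t ^ 2 / 2)

/-- The truncated Gaussian density
`g_s(x) = g(x-s)/∫_0^∞ g(t-s) dt` for `x ≥ 0`, and `g_s(x) = 0` for `x < 0`. -/
def truncGauss (s x : ℝ) : ℝ :=
  if 0 ≤ x then stdGauss (x - s) / (∫ t in Ioi (0 : ℝ), stdGauss (t - s)) else 0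

/-- The upper integral of a (possibly nonmeasurable) nonnegative function: the infimum of the
integrals of measurable functions dominating it. -/
def upperIntegral {α : Type*} [MeasurableSpace α] (μ : Measure α) (f : α → ℝ≥0∞) : ℝ≥0∞ :=
  ⨅ (g : α → ℝ≥0∞) (_ : Measurable g) (_ : ∀ x, f x ≤ g x), ∫⁻ x, g x ∂μ

/-- Quantitative concavity of the logarithm. -/
lemma log_quant {t l M : ℝ} (ht : 0 < t) (hl : 0 < l) (htM : t ≤ M) (hlM : l ≤ M) :
    Real.log t + (t - l) ^ 2 / (4 * M ^ 2) ≤ Real.log l + (t - l) / l := by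
  have hM : 0 < M := lt_of_lt_of_le ht htM
  set r := Real.sqrt (t / l) with hr
  have hr0 : 0 < r := Real.sqrt_pos.mpr (div_pos ht hl)
  have hr2 : r ^ 2 = t / l := Real.sq_sqrt (div_pos ht hl).le
  have ht' : t = l * r ^ 2 := by rw [hr2]; field_simp
  have hlog : Real.log t = Real.log l + 2 * Real.log r := by
    rw [ht', Real.log_mul hl.ne' (by positivity), Real.log_pow]; norm_num
  have h1 : Real.log r ≤ r - 1 := Real.log_le_sub_one_of_pos hr0
  have h2 : l * r ≤ M := by
    rcases le_total r 1 with h | h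
    · nlinarith
    · nlinarith
  have h3 : l * (r + 1) ≤ 2 * M := by linarith
  have h4 : (t - l) ^ 2 / (4 * M ^ 2) ≤ (r - 1) ^ 2 := by
    rw [div_le_iff₀ (by positivity)]
    have : (t - l) ^ 2 = (r - 1) ^ 2 * (l * (r + 1)) ^ 2 := by rw [ht']; ring
    rw [this]
    have h5 : (l * (r + 1)) ^ 2 ≤ (2 * M) ^ 2 := by
      apply pow_le_pow_left₀ (by positivity) h3
    nlinarith [sq_nonneg (r - 1)]
  have h6 : (t - l) / l = r ^ 2 - 1 := by rw [ht']; field_simp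
  rw [hlog, h6]
  nlinarith

section det
variable {E : Type*} [NormedAddCommGroup E] [InnerProductSpace ℝ E] [FiniteDimensional ℝ E]
  {ι : Type*} [Fintype ι]

lemma det_ineq (a : ι → E) (C t : ι → ℝ) (hC : ∀ i, 0 < C i) (ha : ∀ i, ‖a i‖ = 1)
    (hI : ∀ x, ‖x‖ ^ 2 = ∑ i, C i * ⟪a i, x⟫ ^ 2) (ht : ∀ i, 0 < t i)
    (L : E →L[ℝ] E) (hL : ∀ x, L x = ∑ i, (C i * t i * ⟪a i, x⟫) • a i)
    (M : ℝ) (hM : ∀ i, t i ≤ M) :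
    (∏ i, t i ^ C i) * (1 + 1 / (8 * M ^ 2) *
      ∑ i, ∑ j, C i * C j * ⟪a i, a j⟫ ^ 2 * (t i - t j) ^ 2) ≤ L.det := by
  have hLin : ∀ x y, ⟪L x, y⟫ = ∑ i, C i * t i * ⟪a i, x⟫ * ⟪a i, y⟫ := by
    intro x y
    rw [hL, sum_inner]
    exact Finset.sum_congr rfl fun i _ => by rw [real_inner_smul_left]
  have hsym : (L : E →ₗ[ℝ] E).IsSymmetric := by
    intro x y
    simp only [ContinuousLinearMap.coe_coe]
    rw [hLin, real_inner_comm, hLin]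
    exact Finset.sum_congr rfl fun i _ => by ring
  obtain ⟨d, hd⟩ : ∃ d, Module.finrank ℝ E = d := ⟨_, rfl⟩
  set b := hsym.eigenvectorBasis hd with hb
  set l := hsym.eigenvalues hd with hl
  have hLb : ∀ k, L (b k) = l k • b k := fun k => by
    exact hsym.apply_eigenvectorBasis hd k
  have hdet : L.det = ∏ k, l k := by
    have := hsym.det_eq_prod_eigenvalues hd
    simpa [ContinuousLinearMap.det] using this
  set q : ι → Fin d → ℝ := fun i k => ⟪a i, b k⟫ ^ 2 with hq
  have q0 : ∀ i k, 0 ≤ q i k := fun i k => sq_nonneg _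
  have q1 : ∀ k, ∑ i, C i * q i k = 1 := fun k => by
    have := hI (b k)
    rw [b.orthonormal.1 k] at this
    simp only [hq]; linarith
  have q2 : ∀ i, ∑ k, q i k = 1 := fun i => by
    have := b.sum_sq_norm_inner_left (a i)
    rw [ha i] at this
    simpa [hq, Real.norm_eq_abs, sq_abs] using this
  have lk : ∀ k, l k = ∑ i, C i * t i * q i k := fun k => by
    have h1 : ⟪L (b k), b k⟫ = l k := by
      rw [hLb, real_inner_smul_left, real_inner_self_eq_norm_sq, b.orthonormal.1 k]; simp
    rw [← h1, hLin]
    exact Finset.sum_congr rfl fun i _ => by simp only [hq]; ring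
  have lq : ∀ i, ∑ k, l k * q i k = ∑ j, C j * t j * ⟪a i, a j⟫ ^ 2 := fun i => by
    have h1 : ⟪L (a i), a i⟫ = ∑ j, C j * t j * ⟪a i, a j⟫ ^ 2 := by
      rw [hLin]
      exact Finset.sum_congr rfl fun j _ => by rw [real_inner_comm]; ring
    rw [← h1, ← b.sum_inner_mul_inner]
    refine Finset.sum_congr rfl fun k _ => ?_
    have h2 : ⟪L (a i), b k⟫ = l k * ⟪a i, b k⟫ := by
      have := hsym (a i) (b k)
      simp only [ContinuousLinearMap.coe_coe] at this
      rw [this, hLb, real_inner_smul_right]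
    rw [h2, real_inner_comm (a i) (b k)]; simp only [hq]; ring
  have lpos : ∀ k, 0 < l k := fun k => by
    rw [lk]
    by_contra hcon
    have hall : ∀ i, 0 ≤ C i * t i * q i k := fun i =>
      mul_nonneg (mul_pos (hC i) (ht i)).le (q0 i k)
    have hz : ∑ i, C i * t i * q i k = 0 :=
      le_antisymm (not_lt.mp hcon) (Finset.sum_nonneg fun i _ => hall i)
    rw [Finset.sum_eq_zero_iff_of_nonneg (fun i _ => hall i)] at hz
    have : ∑ i, C i * q i k = 0 := Finset.sum_eq_zero fun i hi => by
      have := hz i hi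
      have h3 := (hC i).ne'
      have h4 := (ht i).ne'
      have : q i k = 0 := by simpa [h3, h4] using this
      rw [this, mul_zero]
    linarith [q1 k]
  have lM : ∀ k, l k ≤ M := fun k => by
    rw [lk]
    calc ∑ i, C i * t i * q i k ≤ ∑ i, M * (C i * q i k) :=
          Finset.sum_le_sum fun i _ => by
            have := mul_nonneg (hC i).le (q0 i k)
            nlinarith [hM i]
      _ = M := by rw [← Finset.mul_sum, q1, mul_one]
  -- Jensen for each k
  have jens : ∀ k, ∑ i, C i * q i k * Real.log (t i)
      + ∑ i, C i * q i k * (t i - l k) ^ 2 / (4 * M ^ 2) ≤ Real.log (l k) := fun k => by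
    have h1 : ∑ i, C i * q i k * (Real.log (t i) + (t i - l k) ^ 2 / (4 * M ^ 2)) ≤
        ∑ i, C i * q i k * (Real.log (l k) + (t i - l k) / l k) :=
      Finset.sum_le_sum fun i _ => mul_le_mul_of_nonneg_left
        (log_quant (ht i) (lpos k) (hM i) (lM k)) (mul_nonneg (hC i).le (q0 i k))
    have h2 : ∑ i, C i * q i k * (Real.log (l k) + (t i - l k) / l k) = Real.log (l k) := by
      have : ∀ i, C i * q i k * (Real.log (l k) + (t i - l k) / l k) =
          (C i * q i k) * (Real.log (l k) - 1) + (C i * t i * q i k) * (1 / l k) := fun i => by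
        have := (lpos k).ne'
        field_simp
        ring
      rw [Finset.sum_congr rfl fun i _ => this i, Finset.sum_add_distrib, ← Finset.sum_mul,
        ← Finset.sum_mul, q1, ← lk]
      have := (lpos k).ne'
      field_simp
      ring
    rw [h2] at h1
    refine le_trans (le_of_eq ?_) h1
    rw [← Finset.sum_add_distrib]
    exact Finset.sum_congr rfl fun i _ => by ring
  have hsq : ∑ k, l k ^ 2 = ∑ i, ∑ j, C i * C j * (t i * t j) * ⟪a i, a j⟫ ^ 2 := by
    calc ∑ k, l k ^ 2 = ∑ k, l k * ∑ i, C i * t i * q i k :=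
          Finset.sum_congr rfl fun k _ => by rw [← lk]; ring
      _ = ∑ k, ∑ i, C i * t i * (l k * q i k) := Finset.sum_congr rfl fun k _ => by
          rw [Finset.mul_sum]; exact Finset.sum_congr rfl fun i _ => by ring
      _ = ∑ i, C i * t i * ∑ k, l k * q i k := by
          rw [Finset.sum_comm]; exact Finset.sum_congr rfl fun i _ => by rw [Finset.mul_sum]
      _ = _ := Finset.sum_congr rfl fun i _ => by
          rw [lq, Finset.mul_sum]; exact Finset.sum_congr rfl fun j _ => by ring
  have hp1 : ∀ j, ∑ i, C i * ⟪a i, a j⟫ ^ 2 = 1 := fun j => by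
    have := hI (a j); rw [ha j] at this; linarith
  have hp2 : ∀ i, ∑ j, C j * ⟪a i, a j⟫ ^ 2 = 1 := fun i => by
    rw [← hp1 i]; exact Finset.sum_congr rfl fun j _ => by rw [real_inner_comm]
  have var1 : ∑ i, ∑ j, C i * C j * ⟪a i, a j⟫ ^ 2 * (t i - t j) ^ 2 =
      2 * (∑ i, C i * t i ^ 2 - ∑ k, l k ^ 2) := by
    have e1 : ∀ i j, C i * C j * ⟪a i, a j⟫ ^ 2 * (t i - t j) ^ 2 =
      (C i * t i ^ 2) * (C j * ⟪a i, a j⟫ ^ 2) + (C j * t j ^ 2) * (C i * ⟪a i, a j⟫ ^ 2)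
        - 2 * (C i * C j * (t i * t j) * ⟪a i, a j⟫ ^ 2) := fun i j => by ring
    simp only [e1, Finset.sum_sub_distrib, Finset.sum_add_distrib]
    have e2 : ∑ i, ∑ j, (C i * t i ^ 2) * (C j * ⟪a i, a j⟫ ^ 2) = ∑ i, C i * t i ^ 2 :=
      Finset.sum_congr rfl fun i _ => by rw [← Finset.mul_sum, hp2, mul_one]
    have e3 : ∑ i, ∑ j, (C j * t j ^ 2) * (C i * ⟪a i, a j⟫ ^ 2) = ∑ i, C i * t i ^ 2 := by
      rw [Finset.sum_comm]
      exact Finset.sum_congr rfl fun i _ => by rw [← Finset.mul_sum, hp1, mul_one]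
    have e4 : ∑ i, ∑ j, 2 * (C i * C j * (t i * t j) * ⟪a i, a j⟫ ^ 2) = 2 * ∑ k, l k ^ 2 := by
      rw [hsq, Finset.mul_sum]
      exact Finset.sum_congr rfl fun i _ => by rw [Finset.mul_sum]
    rw [e2, e3, e4]; ring
  have var2 : ∑ k, ∑ i, C i * q i k * (t i - l k) ^ 2 = ∑ i, C i * t i ^ 2 - ∑ k, l k ^ 2 := by
    have e1 : ∀ k i, C i * q i k * (t i - l k) ^ 2 =
      (C i * t i ^ 2) * q i k - 2 * l k * (C i * t i * q i k) + l k ^ 2 * (C i * q i k) :=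
      fun k i => by ring
    simp only [e1, Finset.sum_sub_distrib, Finset.sum_add_distrib]
    have e2 : ∑ k, ∑ i, (C i * t i ^ 2) * q i k = ∑ i, C i * t i ^ 2 := by
      rw [Finset.sum_comm]
      exact Finset.sum_congr rfl fun i _ => by rw [← Finset.mul_sum, q2, mul_one]
    have e3 : ∑ k, ∑ i, 2 * l k * (C i * t i * q i k) = 2 * ∑ k, l k ^ 2 := by
      rw [Finset.mul_sum]
      exact Finset.sum_congr rfl fun k _ => by rw [← Finset.mul_sum, ← lk]; ring
    have e4 : ∑ k, ∑ i, l k ^ 2 * (C i * q i k) = ∑ k, l k ^ 2 :=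
      Finset.sum_congr rfl fun k _ => by rw [← Finset.mul_sum, q1, mul_one]
    rw [e2, e3, e4]; ring
  have tot : ∑ i, C i * Real.log (t i) + (1 / (8 * M ^ 2) *
      ∑ i, ∑ j, C i * C j * ⟪a i, a j⟫ ^ 2 * (t i - t j) ^ 2) ≤ ∑ k, Real.log (l k) := by
    refine le_trans (le_of_eq ?_) (Finset.sum_le_sum fun k _ => jens k)
    rw [Finset.sum_add_distrib]
    have e1 : ∑ k, ∑ i, C i * q i k * Real.log (t i) = ∑ i, C i * Real.log (t i) := by
      rw [Finset.sum_comm]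
      refine Finset.sum_congr rfl fun i _ => ?_
      have : ∀ k, C i * q i k * Real.log (t i) = (C i * Real.log (t i)) * q i k := fun k => by ring
      rw [Finset.sum_congr rfl fun k _ => this k, ← Finset.mul_sum, q2, mul_one]
    have e2 : ∑ k, ∑ i, C i * q i k * (t i - l k) ^ 2 / (4 * M ^ 2) =
        (∑ k, ∑ i, C i * q i k * (t i - l k) ^ 2) / (4 * M ^ 2) := by
      simp only [Finset.sum_div]
    rw [e1, e2, var2, var1]
    ring
  rw [hdet]
  have e5 : ∏ k, l k = Real.exp (∑ k, Real.log (l k)) := by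
    rw [Real.exp_sum]; exact Finset.prod_congr rfl fun k _ => (Real.exp_log (lpos k)).symm
  have e6 : ∏ i, t i ^ C i = Real.exp (∑ i, C i * Real.log (t i)) := by
    rw [Real.exp_sum]; exact Finset.prod_congr rfl fun i _ => by
      rw [Real.rpow_def_of_pos (ht i), mul_comm]
  rw [e5, e6]
  refine le_trans ?_ (Real.exp_le_exp.mpr tot)
  rw [Real.exp_add]
  apply mul_le_mul_of_nonneg_left _ (Real.exp_pos _).le
  linarith [Real.add_one_le_exp (1 / (8 * M ^ 2) *
      ∑ i, ∑ j, C i * C j * ⟪a i, a j⟫ ^ 2 * (t i - t j) ^ 2)]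

lemma det_ineq' (a : ι → E) (C t : ι → ℝ) (hC : ∀ i, 0 < C i) (ha : ∀ i, ‖a i‖ = 1)
    (hI : ∀ x, ‖x‖ ^ 2 = ∑ i, C i * ⟪a i, x⟫ ^ 2) (ht : ∀ i, 0 < t i)
    (L : E →L[ℝ] E) (hL : ∀ x, L x = ∑ i, (C i * t i * ⟪a i, x⟫) • a i) :
    (∏ i, t i ^ C i) ≤ L.det := by
  refine le_trans ?_ (det_ineq a C t hC ha hI ht L hL (∑ i, t i) fun i =>
    Finset.single_le_sum (f := t) (fun j _ => (ht j).le) (Finset.mem_univ i))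
  apply le_mul_of_one_le_right (Finset.prod_nonneg fun i _ => Real.rpow_nonneg (ht i).le _)
  have : 0 ≤ 1 / (8 * (∑ i, t i) ^ 2) *
      ∑ i, ∑ j, C i * C j * ⟪a i, a j⟫ ^ 2 * (t i - t j) ^ 2 := by
    apply mul_nonneg (by positivity)
    refine Finset.sum_nonneg fun i _ => Finset.sum_nonneg fun j _ => ?_
    have := hC i; have := hC j
    positivity
  linarith

end det

lemma stdGauss_eq : stdGauss = ProbabilityTheory.gaussianPDFReal 0 1 := by
  funext x
  simp [stdGauss, ProbabilityTheory.gaussianPDFReal]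

lemma stdGauss_pos (x : ℝ) : 0 < stdGauss x := by
  unfold stdGauss; positivity

lemma continuous_stdGauss : Continuous stdGauss := by
  unfold stdGauss; fun_prop

lemma integrable_stdGauss : Integrable stdGauss := by
  rw [stdGauss_eq]; exact ProbabilityTheory.integrable_gaussianPDFReal 0 1

lemma integral_stdGauss : ∫ x, stdGauss x = 1 := by
  rw [stdGauss_eq]; exact ProbabilityTheory.integral_gaussianPDFReal_eq_one 0 one_ne_zero

lemma stdGauss_neg (x : ℝ) : stdGauss (-x) = stdGauss x := by simp [stdGauss]

lemma inv_sqrt_two_pi_bounds :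
    0.39 ≤ (Real.sqrt (2 * Real.pi))⁻¹ ∧ (Real.sqrt (2 * Real.pi))⁻¹ ≤ 0.4 := by
  have h1 := Real.pi_gt_d4
  have h2 := Real.pi_lt_d4
  have hp : 0 < Real.sqrt (2 * Real.pi) := by positivity
  constructor
  · rw [le_inv_comm₀ (by norm_num) hp, Real.sqrt_le_left (by norm_num)]
    norm_num; linarith
  · rw [inv_le_comm₀ hp (by norm_num)]
    apply Real.le_sqrt_of_sq_le
    norm_num; linarith

lemma stdGauss_le (x : ℝ) : stdGauss x ≤ 0.4 := by
  unfold stdGauss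
  have h := inv_sqrt_two_pi_bounds.2
  have h0 : 0 < (Real.sqrt (2 * Real.pi))⁻¹ := by positivity
  have : Real.exp (-x ^ 2 / 2) ≤ 1 := Real.exp_le_one_iff.mpr (by nlinarith [sq_nonneg x])
  nlinarith [Real.exp_pos (-x ^ 2 / 2)]

lemma stdGauss_ge {x r : ℝ} (h : x ^ 2 ≤ r) : 0.39 * (1 - r / 2) ≤ stdGauss x := by
  unfold stdGauss
  have h1 := inv_sqrt_two_pi_bounds.1
  have : 1 - r / 2 ≤ Real.exp (-x ^ 2 / 2) := by
    have := Real.add_one_le_exp (-x ^ 2 / 2); linarith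
  have h2 := Real.exp_pos (-x ^ 2 / 2)
  nlinarith

/-- Gaussian distribution function. -/
def gCdf (y : ℝ) : ℝ := ∫ t in Iic y, stdGauss t

lemma gCdf_sub {a b : ℝ} : gCdf b - gCdf a = ∫ t in a..b, stdGauss t :=
  intervalIntegral.integral_Iic_sub_Iic integrable_stdGauss.integrableOn
    integrable_stdGauss.integrableOn

lemma hasDerivAt_gCdf (y : ℝ) : HasDerivAt gCdf (stdGauss y) y := by
  have h : gCdf = fun y => gCdf 0 + ∫ t in (0 : ℝ)..y, stdGauss t := by
    funext y
    have : gCdf y - gCdf 0 = ∫ t in (0 : ℝ)..y, stdGauss t :=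
      intervalIntegral.integral_Iic_sub_Iic integrable_stdGauss.integrableOn
        integrable_stdGauss.integrableOn
    linarith
  rw [h]
  exact (intervalIntegral.integral_hasDerivAt_right
    (continuous_stdGauss.intervalIntegrable _ _)
    continuous_stdGauss.stronglyMeasurable.stronglyMeasurableAtFilter
    continuous_stdGauss.continuousAt).const_add _

lemma continuous_gCdf : Continuous gCdf :=
  continuous_iff_continuousAt.mpr fun y => (hasDerivAt_gCdf y).continuousAt

lemma strictMono_gCdf : StrictMono gCdf :=
  strictMono_of_hasDerivAt_pos hasDerivAt_gCdf stdGauss_pos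

lemma gCdf_eq_cdf : gCdf = ProbabilityTheory.cdf (ProbabilityTheory.gaussianReal 0 1) := by
  funext y
  rw [ProbabilityTheory.cdf_eq_real, Measure.real,
    ProbabilityTheory.gaussianReal_apply_eq_integral 0 one_ne_zero,
    ENNReal.toReal_ofReal, gCdf, stdGauss_eq]
  exact integral_nonneg fun x => ProbabilityTheory.gaussianPDFReal_nonneg _ _ _

lemma gCdf_neg (y : ℝ) : gCdf (-y) = 1 - gCdf y := by
  have h1 : gCdf (-y) = ∫ t in Ioi y, stdGauss t := by
    unfold gCdf
    rw [← integral_comp_neg_Ioi]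
    simp [stdGauss_neg]
  have h2 : gCdf y + ∫ t in Ioi y, stdGauss t = 1 := by
    rw [← integral_stdGauss]
    have := integral_add_compl (μ := volume) (f := stdGauss) (s := Iic y) measurableSet_Iic
      integrable_stdGauss
    rwa [compl_Iic] at this
  linarith

lemma gCdf_pos (y : ℝ) : 0 < gCdf y := by
  have h : gCdf (y - 1) < gCdf y := strictMono_gCdf (by linarith)
  have : 0 ≤ gCdf (y - 1) := integral_nonneg fun x => (stdGauss_pos x).le
  linarith

lemma gCdf_lt_one (y : ℝ) : gCdf y < 1 := by
  have := gCdf_pos (-y)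
  rw [gCdf_neg] at this; linarith

lemma gCdf_zero : gCdf 0 = 1 / 2 := by
  have := gCdf_neg 0
  rw [neg_zero] at this; linarith

lemma gCdf_surj {p : ℝ} (h0 : 0 < p) (h1 : p < 1) : ∃ y, gCdf y = p := by
  have hb : Filter.Tendsto gCdf Filter.atBot (nhds 0) := by
    rw [gCdf_eq_cdf]; exact ProbabilityTheory.tendsto_cdf_atBot _
  have ht : Filter.Tendsto gCdf Filter.atTop (nhds 1) := by
    rw [gCdf_eq_cdf]; exact ProbabilityTheory.tendsto_cdf_atTop _
  obtain ⟨a, ha⟩ := (hb.eventually (gt_mem_nhds h0)).exists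
  obtain ⟨b, hb⟩ := (ht.eventually (lt_mem_nhds h1)).exists
  exact mem_range_of_exists_le_of_exists_ge continuous_gCdf ⟨a, ha.le⟩ ⟨b, hb.le⟩

/-- Gaussian quantile function. -/
def gQ : ℝ → ℝ := Function.invFun gCdf

lemma gQ_gCdf (y : ℝ) : gQ (gCdf y) = y := Function.leftInverse_invFun strictMono_gCdf.injective y

lemma gCdf_gQ {p : ℝ} (h0 : 0 < p) (h1 : p < 1) : gCdf (gQ p) = p := by
  obtain ⟨y, rfl⟩ := gCdf_surj h0 h1
  rw [gQ_gCdf]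

lemma hasDerivAt_gQ {p : ℝ} (h0 : 0 < p) (h1 : p < 1) :
    HasDerivAt gQ (stdGauss (gQ p))⁻¹ p := by
  obtain ⟨y, rfl⟩ := gCdf_surj h0 h1
  rw [gQ_gCdf]
  have hs : HasStrictDerivAt gCdf (stdGauss y) y :=
    hasStrictDerivAt_of_hasDerivAt_of_continuousAt
      (Filter.Eventually.of_forall hasDerivAt_gCdf) continuous_stdGauss.continuousAt
  exact (hs.to_local_left_inverse (stdGauss_pos y).ne'
    (Filter.Eventually.of_forall gQ_gCdf)).hasDerivAt

lemma gQ_le {p y : ℝ} (h0 : 0 < p) (h1 : p < 1) (h : p ≤ gCdf y) : gQ p ≤ y := by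
  rw [← strictMono_gCdf.le_iff_le, gCdf_gQ h0 h1]; exact h

lemma le_gQ {p y : ℝ} (h0 : 0 < p) (h1 : p < 1) (h : gCdf y ≤ p) : y ≤ gQ p := by
  rw [← strictMono_gCdf.le_iff_le, gCdf_gQ h0 h1]; exact h

lemma lt_gQ {p y : ℝ} (h0 : 0 < p) (h1 : p < 1) (h : gCdf y < p) : y < gQ p := by
  rw [← strictMono_gCdf.lt_iff_lt, gCdf_gQ h0 h1]; exact h

/-- Tail bound. -/
lemma gCdf_tail {L : ℝ} (hL : 0 < L) : gCdf (-L) ≤ 0.4 * (2 / L) * Real.exp (-L ^ 2 / 2) := by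
  have h1 : gCdf (-L) ≤ ∫ t in Iic (-L), 0.4 * Real.exp (L / 2 * t) := by
    apply setIntegral_mono_on integrable_stdGauss.integrableOn _ measurableSet_Iic
    · intro t ht
      have ht' : t ≤ -L := ht
      unfold stdGauss
      apply mul_le_mul inv_sqrt_two_pi_bounds.2 _ (Real.exp_pos _).le (by norm_num)
      apply Real.exp_le_exp.mpr
      nlinarith
    · exact (integrableOn_exp_mul_Iic (by positivity) _).const_mul _
  rw [integral_const_mul, integral_exp_mul_Iic (by positivity)] at h1
  refine h1.trans (le_of_eq ?_)
  have : L / 2 * -L = -L ^ 2 / 2 := by ring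
  rw [this]
  field_simp

lemma exp_neg_two_le : Real.exp (-2) ≤ 0.25 := by
  have h := Real.exp_one_gt_d9
  have : Real.exp (-2) = (Real.exp 1)⁻¹ ^ 2 := by
    rw [← Real.exp_neg, ← Real.exp_nat_mul]; norm_num
  rw [this]
  have : (Real.exp 1)⁻¹ ≤ 0.5 := by
    rw [inv_le_comm₀ (by positivity) (by norm_num)]; norm_num; linarith
  nlinarith [inv_pos.mpr (Real.exp_pos 1)]

lemma gCdf_neg_two : gCdf (-2) ≤ 0.25 := by
  have := gCdf_tail (L := 2) (by norm_num)
  have h2 := exp_neg_two_le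
  norm_num at this
  linarith

lemma gCdf_neg_three : gCdf (-3) ≤ 0.02 := by
  have := gCdf_tail (L := 3) (by norm_num)
  have h2 := exp_neg_two_le
  have h3 : Real.exp (-3 ^ 2 / 2) ≤ Real.exp (-2) * Real.exp (-2) := by
    rw [← Real.exp_add]; apply Real.exp_le_exp.mpr; norm_num
  have h4 : Real.exp (-2) * Real.exp (-2) ≤ 0.25 * 0.25 :=
    mul_le_mul h2 h2 (Real.exp_pos _).le (by norm_num)
  norm_num at this h3 h4 ⊢
  linarith

lemma gCdf_lower {a b m : ℝ} (hab : a ≤ b) (h : ∀ t ∈ Icc a b, m ≤ stdGauss t) :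
    m * (b - a) ≤ gCdf b - gCdf a := by
  rw [gCdf_sub]
  have := intervalIntegral.integral_mono_on (μ := volume) hab (f := fun _ => m) (g := stdGauss)
    intervalIntegrable_const (continuous_stdGauss.intervalIntegrable _ _) h
  simp at this; linarith

lemma gCdf_upper {a b : ℝ} (hab : a ≤ b) : gCdf b - gCdf a ≤ 0.4 * (b - a) := by
  rw [gCdf_sub]
  have := intervalIntegral.integral_mono_on (μ := volume) hab (f := stdGauss) (g := fun _ => (0.4 : ℝ))
    (continuous_stdGauss.intervalIntegrable _ _) intervalIntegrable_const (fun t _ => stdGauss_le t)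
  simp at this; linarith

/-- Normalizing constant. -/
def gZ (s : ℝ) : ℝ := 1 - gCdf (-s)

lemma gZ_eq (s : ℝ) : ∫ t in Ioi (0 : ℝ), stdGauss (t - s) = gZ s := by
  have h1 : gCdf s = ∫ t in Ioi (-s), stdGauss t := by
    unfold gCdf
    have := integral_comp_neg_Ioi (c := -s) (f := stdGauss)
    rw [neg_neg] at this
    rw [← this]; simp [stdGauss_neg]
  have h2 : gZ s = gCdf s := by unfold gZ; rw [gCdf_neg]; ring
  rw [h2, h1]
  have h3 := (measurePreserving_sub_right (volume : Measure ℝ) s).setIntegral_preimage_emb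
    (MeasurableEquiv.subRight s).measurableEmbedding stdGauss (Ioi (-s))
  rw [← h3]
  congr 2
  ext t; simp

lemma gZ_ge {s : ℝ} (hs : 0 ≤ s) : 1 / 2 ≤ gZ s := by
  have : gCdf (-s) ≤ gCdf 0 := strictMono_gCdf.monotone (by linarith)
  rw [gCdf_zero] at this; unfold gZ; linarith

lemma gZ_lt (s : ℝ) : gZ s < 1 := by
  have := gCdf_pos (-s); unfold gZ; linarith

lemma gZ_pos (s : ℝ) : 0 < gZ s := by
  have := gCdf_lt_one (-s); unfold gZ; linarith

lemma truncGauss_of_nonneg {s x : ℝ} (hx : 0 ≤ x) : truncGauss s x = stdGauss (x - s) / gZ s := by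
  unfold truncGauss; rw [if_pos hx, gZ_eq]

lemma truncGauss_nonneg (s x : ℝ) : 0 ≤ truncGauss s x := by
  rcases le_or_gt 0 x with h | h
  · rw [truncGauss_of_nonneg h]; exact (div_pos (stdGauss_pos _) (gZ_pos s)).le
  · unfold truncGauss; rw [if_neg (not_le.mpr h)]

/-- Ratio of Gaussian densities. -/
lemma stdGauss_mul_exp (x y : ℝ) : stdGauss x * Real.exp ((x ^ 2 - y ^ 2) / 2) = stdGauss y := by
  unfold stdGauss
  rw [mul_assoc, ← Real.exp_add]
  congr 2; ring

lemma stdGauss_div (x y : ℝ) : (stdGauss x)⁻¹ * stdGauss y = Real.exp ((x ^ 2 - y ^ 2) / 2) := by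
  rw [← stdGauss_mul_exp x y]
  have := (stdGauss_pos x).ne'
  field_simp

/-! ### The transport map from the Gaussian to the truncated Gaussian -/

def trS (s y : ℝ) : ℝ := s + gQ (1 - gZ s * (1 - gCdf y))

def trS' (s y : ℝ) : ℝ := gZ s * Real.exp (((trS s y - s) ^ 2 - y ^ 2) / 2)

lemma trS_arg (s y : ℝ) :
    gCdf (-s) < 1 - gZ s * (1 - gCdf y) ∧ 1 - gZ s * (1 - gCdf y) < 1 := by
  have h1 := gCdf_pos y
  have h2 := gCdf_lt_one y
  have h3 := gZ_pos s
  have h4 : gCdf (-s) = 1 - gZ s := by unfold gZ; ring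
  rw [h4]
  constructor <;> nlinarith

lemma trS_pos (s y : ℝ) : 0 < trS s y := by
  have h := trS_arg s y
  have := lt_gQ ((gCdf_pos _).trans h.1) h.2 h.1
  unfold trS; linarith

lemma hasDerivAt_trS (s y : ℝ) : HasDerivAt (trS s) (trS' s y) y := by
  have h := trS_arg s y
  have h1 := hasDerivAt_gQ ((gCdf_pos _).trans h.1) h.2
  have h2 : HasDerivAt (fun y => 1 - gZ s * (1 - gCdf y)) (gZ s * stdGauss y) y := by
    have := (((hasDerivAt_gCdf y).const_sub 1).const_mul (gZ s)).const_sub 1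
    exact this.congr_deriv (by ring)
  have h3 := (h1.comp y h2).const_add s
  have e : trS' s y = (stdGauss (gQ (1 - gZ s * (1 - gCdf y))))⁻¹ * (gZ s * stdGauss y) := by
    unfold trS'
    have : trS s y - s = gQ (1 - gZ s * (1 - gCdf y)) := by unfold trS; ring
    rw [this, ← stdGauss_div]; ring
  rw [e]
  exact h3

lemma trS'_pos (s y : ℝ) : 0 < trS' s y := mul_pos (gZ_pos s) (Real.exp_pos _)

lemma truncGauss_trS (s y : ℝ) : truncGauss s (trS s y) * trS' s y = stdGauss y := by
  rw [truncGauss_of_nonneg (trS_pos s y).le, trS', ← stdGauss_mul_exp (trS s y - s) y]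
  have := (gZ_pos s).ne'
  field_simp

lemma trS'_le {s y : ℝ} (hs : 0 ≤ s) (hs' : s ≤ 0.15) (hy : y ≤ 0) : trS' s y ≤ 8 := by
  have h := trS_arg s y
  have h1 : trS s y - s ≤ 2 := by
    have : trS s y - s = gQ (1 - gZ s * (1 - gCdf y)) := by unfold trS; ring
    rw [this]
    apply gQ_le ((gCdf_pos _).trans h.1) h.2
    have h2 : gCdf y ≤ 1 / 2 := by
      rw [← gCdf_zero]; exact strictMono_gCdf.monotone hy
    have h3 := gCdf_neg_two
    rw [gCdf_neg] at h3
    have := gZ_ge hs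
    nlinarith
  have h2 := trS_pos s y
  have h3 : ((trS s y - s) ^ 2 - y ^ 2) / 2 ≤ 2 := by nlinarith [sq_nonneg y]
  have h4 : Real.exp (((trS s y - s) ^ 2 - y ^ 2) / 2) ≤ 8 := by
    refine (Real.exp_le_exp.mpr h3).trans ?_
    have : Real.exp 2 = Real.exp 1 ^ 2 := by rw [← Real.exp_nat_mul]; norm_num
    rw [this]
    nlinarith [Real.exp_one_lt_d9, Real.exp_pos 1]
  unfold trS'
  nlinarith [gZ_lt s, gZ_pos s, Real.exp_pos (((trS s y - s) ^ 2 - y ^ 2) / 2)]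

lemma trS'_deriv (s y : ℝ) :
    HasDerivAt (trS' s) (trS' s y * ((trS s y - s) * trS' s y - y)) y := by
  have h1 : HasDerivAt (fun y => ((trS s y - s) ^ 2 - y ^ 2) / 2)
      ((trS s y - s) * trS' s y - y) y := by
    have := ((((hasDerivAt_trS s y).sub_const s).pow 2).sub ((hasDerivAt_id y).pow 2)).div_const 2
    exact this.congr_deriv (by simp; ring)
  have := (h1.exp).const_mul (gZ s)
  exact this.congr_deriv (by unfold trS'; ring)

lemma trS'_growth {s : ℝ} (hs : 0 ≤ s) (hs' : s ≤ 0.15) {a b : ℝ} (ha : -1 ≤ a) (hab : a ≤ b)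
    (hb : b ≤ -1 / 2) : 0.05 * (b - a) ≤ trS' s b - trS' s a := by
  have key : ∀ y ∈ Icc (-1 : ℝ) (-1 / 2),
      0.05 ≤ trS' s y * ((trS s y - s) * trS' s y - y) := by
    intro y hy
    have hp := trS_pos s y
    have hy1 := hy.1
    have hy2 := hy.2
    have h1 : 0.25 ≤ trS' s y := by
      unfold trS'
      have := gZ_ge hs
      have h2 := Real.add_one_le_exp (((trS s y - s) ^ 2 - y ^ 2) / 2)
      have h3 : (1 / 2 : ℝ) ≤ ((trS s y - s) ^ 2 - y ^ 2) / 2 + 1 := by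
        nlinarith [sq_nonneg (trS s y - s)]
      nlinarith
    have h2 : 0.2 ≤ (trS s y - s) * trS' s y - y := by
      rcases le_total s (trS s y) with h | h
      · have := mul_nonneg (sub_nonneg.mpr h) (trS'_pos s y).le
        linarith
      · have h3 : trS' s y ≤ 1 := by
          unfold trS'
          have : Real.exp (((trS s y - s) ^ 2 - y ^ 2) / 2) ≤ 1 := by
            apply Real.exp_le_one_iff.mpr
            nlinarith
          nlinarith [gZ_lt s, gZ_pos s, Real.exp_pos (((trS s y - s) ^ 2 - y ^ 2) / 2)]
        nlinarith [trS'_pos s y]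
    nlinarith
  have := (convex_Icc (-1 : ℝ) (-1 / 2)).mul_sub_le_image_sub_of_le_deriv (f := trS' s)
    (fun y _ => (trS'_deriv s y).continuousAt.continuousWithinAt)
    (fun y _ => (trS'_deriv s y).differentiableAt.differentiableWithinAt)
    (C := 0.05) (fun y hy => by
      rw [(trS'_deriv s y).deriv]; exact key y (interior_subset hy))
    a ⟨ha, hab.trans hb⟩ b ⟨ha.trans hab, hb⟩ hab
  exact this

/-! ### The transport map from the truncated Gaussian to the Gaussian -/

def trT (s x : ℝ) : ℝ := gQ ((gCdf (x - s) - gCdf (-s)) / gZ s)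

def trT' (s x : ℝ) : ℝ := (gZ s)⁻¹ * Real.exp ((trT s x ^ 2 - (x - s) ^ 2) / 2)

lemma trT_arg {s x : ℝ} (hx : 0 < x) :
    0 < (gCdf (x - s) - gCdf (-s)) / gZ s ∧ (gCdf (x - s) - gCdf (-s)) / gZ s < 1 := by
  have h1 : gCdf (-s) < gCdf (x - s) := strictMono_gCdf (by linarith)
  have h2 := gCdf_lt_one (x - s)
  have h3 := gZ_pos s
  refine ⟨div_pos (by linarith) h3, ?_⟩
  rw [div_lt_one h3]; unfold gZ; linarith

lemma hasDerivAt_trT {s x : ℝ} (hx : 0 < x) : HasDerivAt (trT s) (trT' s x) x := by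
  have h := trT_arg (s := s) hx
  have h1 := hasDerivAt_gQ h.1 h.2
  have h2 : HasDerivAt (fun x => (gCdf (x - s) - gCdf (-s)) / gZ s) (stdGauss (x - s) / gZ s) x :=
    (((hasDerivAt_gCdf (x - s)).comp_sub_const x s).sub_const _).div_const _
  have h3 := h1.comp x h2
  have e : trT' s x = (stdGauss (trT s x))⁻¹ * (stdGauss (x - s) / gZ s) := by
    unfold trT'
    rw [← stdGauss_div]; ring
  rw [e]
  exact h3

lemma trT'_pos (s x : ℝ) : 0 < trT' s x := mul_pos (inv_pos.mpr (gZ_pos s)) (Real.exp_pos _)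

lemma truncGauss_trT {s x : ℝ} (hx : 0 < x) :
    stdGauss (trT s x) * trT' s x = truncGauss s x := by
  rw [truncGauss_of_nonneg hx.le, trT', ← stdGauss_mul_exp (trT s x) (x - s)]
  have := (gZ_pos s).ne'
  field_simp

lemma trT_bounds {s x : ℝ} (hs : 0 ≤ s) (hs' : s ≤ 0.15) (hx : 1 / 16 ≤ x) (hx' : x ≤ 1 / 8) :
    -3 ≤ trT s x ∧ trT s x ≤ -1 / 2 := by
  have h := trT_arg (s := s) (x := x) (by linarith)
  have hZ := gZ_ge hs
  constructor
  · apply le_gQ h.1 h.2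
    refine gCdf_neg_three.trans ?_
    rw [le_div_iff₀ (gZ_pos s)]
    have := gCdf_lower (a := -s) (b := x - s) (m := 0.38) (by linarith) (fun t ht => by
      have := stdGauss_ge (x := t) (r := 0.03) (by nlinarith [ht.1, ht.2])
      norm_num at this ⊢; linarith)
    have := gZ_lt s
    nlinarith
  · apply gQ_le h.1 h.2
    have h1 : 0.1 ≤ gCdf (-1 / 2) := by
      have h2 := gCdf_lower (a := -1) (b := -1 / 2) (m := 0.195) (by norm_num) (fun t ht => by
        have := stdGauss_ge (x := t) (r := 1) (by nlinarith [ht.1, ht.2])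
        norm_num at this ⊢; linarith)
      have h3 := gCdf_lower (a := -5/4) (b := -1) (m := 0.085) (by norm_num) (fun t ht => by
        have := stdGauss_ge (x := t) (r := 25 / 16) (by nlinarith [ht.1, ht.2])
        norm_num at this ⊢; linarith)
      have := gCdf_pos (-5/4)
      norm_num at h2 h3 ⊢
      linarith
    refine le_trans ?_ h1
    rw [div_le_iff₀ (gZ_pos s)]
    have := gCdf_upper (a := -s) (b := x - s) (by linarith)
    nlinarith

lemma trT'_le {s x : ℝ} (hs : 0 ≤ s) (hs' : s ≤ 0.15) (hx : 1 / 16 ≤ x) (hx' : x ≤ 1 / 8) :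
    trT' s x ≤ 200 := by
  have h := trT_bounds hs hs' hx hx'
  have h1 : (trT s x ^ 2 - (x - s) ^ 2) / 2 ≤ 4.5 := by
    nlinarith [h.1, h.2, sq_nonneg (x - s)]
  have h2 : Real.exp ((trT s x ^ 2 - (x - s) ^ 2) / 2) ≤ 100 := by
    refine (Real.exp_le_exp.mpr h1).trans ?_
    have e1 := Real.exp_one_lt_d9
    have e2 : Real.exp 4.5 ^ 2 = Real.exp 1 ^ 9 := by
      rw [← Real.exp_nat_mul, ← Real.exp_nat_mul]; norm_num
    have e3 : Real.exp 1 ^ 9 ≤ 2.72 ^ 9 := pow_le_pow_left₀ (Real.exp_pos 1).le (by linarith) 9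
    refine (abs_le_of_sq_le_sq' ?_ (by norm_num)).2
    rw [e2]; refine e3.trans (by norm_num)
  have h3 : (gZ s)⁻¹ ≤ 2 := by
    rw [inv_le_comm₀ (gZ_pos s) (by norm_num)]; have := gZ_ge hs; linarith
  unfold trT'
  have := inv_pos.mpr (gZ_pos s)
  nlinarith [Real.exp_pos ((trT s x ^ 2 - (x - s) ^ 2) / 2)]

lemma trT'_deriv {s x : ℝ} (hx : 0 < x) :
    HasDerivAt (trT' s) (trT' s x * (trT s x * trT' s x - (x - s))) x := by
  have h1 : HasDerivAt (fun x => (trT s x ^ 2 - (x - s) ^ 2) / 2)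
      (trT s x * trT' s x - (x - s)) x := by
    have := (((hasDerivAt_trT (s := s) hx).pow 2).sub
      (((hasDerivAt_id x).sub_const s).pow 2)).div_const 2
    exact this.congr_deriv (by simp; ring)
  have := (h1.exp).const_mul (gZ s)⁻¹
  exact this.congr_deriv (by unfold trT'; ring)

lemma trT'_growth {s : ℝ} (hs : 0 ≤ s) (hs' : s ≤ 0.15) {a b : ℝ} (ha : 1 / 16 ≤ a) (hab : a ≤ b)
    (hb : b ≤ 1 / 8) : 0.3 * (b - a) ≤ trT' s a - trT' s b := by
  have key : ∀ x ∈ Icc (1 / 16 : ℝ) (1 / 8),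
      trT' s x * (trT s x * trT' s x - (x - s)) ≤ -0.3 := by
    intro x hx
    have h := trT_bounds hs hs' hx.1 hx.2
    have hx1 := hx.1
    have hx2 := hx.2
    have h1 : 1 ≤ trT' s x := by
      unfold trT'
      have h3 : 1 ≤ (gZ s)⁻¹ := (one_le_inv₀ (gZ_pos s)).mpr (gZ_lt s).le
      have h2 : 1 ≤ Real.exp ((trT s x ^ 2 - (x - s) ^ 2) / 2) := by
        apply Real.one_le_exp
        nlinarith [h.2]
      nlinarith
    have h2 : trT s x * trT' s x - (x - s) ≤ -0.3 := by
      nlinarith [h.2]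
    nlinarith
  have := (convex_Icc (1 / 16 : ℝ) (1 / 8)).image_sub_le_mul_sub_of_deriv_le (f := trT' s)
    (fun x hx => (trT'_deriv (by linarith [hx.1])).continuousAt.continuousWithinAt)
    (fun x hx => (trT'_deriv (by linarith [(interior_subset hx).1])).differentiableAt.differentiableWithinAt)
    (C := -0.3) (fun x hx => by
      rw [(trT'_deriv (by linarith [(interior_subset hx).1])).deriv]
      exact key x (interior_subset hx))
    a ⟨ha, hab.trans hb⟩ b ⟨ha.trans hab, hb⟩ hab
  linarith

section transport
variable {N : ℕ} {ι : Type*} [Fintype ι]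

/-- The Brascamp-Lieb transport map. -/
def blMap (a : ι → EuclideanSpace ℝ (Fin N)) (C : ι → ℝ) (f : ℝ → ℝ)
    (x : EuclideanSpace ℝ (Fin N)) : EuclideanSpace ℝ (Fin N) := ∑ i, (C i * f ⟪a i, x⟫) • a i

/-- Its derivative. -/
def blD (a : ι → EuclideanSpace ℝ (Fin N)) (C : ι → ℝ) (f' : ℝ → ℝ)
    (x : EuclideanSpace ℝ (Fin N)) : EuclideanSpace ℝ (Fin N) →L[ℝ] EuclideanSpace ℝ (Fin N) :=
  ∑ i, ((C i * f' ⟪a i, x⟫) • innerSL ℝ (a i)).smulRight (a i)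

lemma blD_apply (a : ι → EuclideanSpace ℝ (Fin N)) (C : ι → ℝ) (f' : ℝ → ℝ)
    (x v : EuclideanSpace ℝ (Fin N)) :
    blD a C f' x v = ∑ i, (C i * f' ⟪a i, x⟫ * ⟪a i, v⟫) • a i := by
  simp [blD]

lemma hasFDerivAt_blMap (a : ι → EuclideanSpace ℝ (Fin N)) (C : ι → ℝ) (f f' : ℝ → ℝ)
    (x : EuclideanSpace ℝ (Fin N)) (h : ∀ i, HasDerivAt f (f' ⟪a i, x⟫) ⟪a i, x⟫) :
    HasFDerivAt (blMap a C f) (blD a C f' x) x := by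
  unfold blMap blD
  apply HasFDerivAt.fun_sum
  intro i _
  have h1 : HasFDerivAt (fun x : EuclideanSpace ℝ (Fin N) => ⟪a i, x⟫) (innerSL ℝ (a i)) x :=
    (innerSL ℝ (a i)).hasFDerivAt
  have h2 := ((h i).comp_hasFDerivAt x h1).const_mul (C i)
  have h3 := h2.smul_const (a i)
  rw [smul_smul] at h3
  exact h3

lemma injOn_blMap (a : ι → EuclideanSpace ℝ (Fin N)) (C : ι → ℝ) (hC : ∀ i, 0 < C i)
    (hI : ∀ x, ‖x‖ ^ 2 = ∑ i, C i * ⟪a i, x⟫ ^ 2) (f : ℝ → ℝ) (V : Set ℝ)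
    (hf : StrictMonoOn f V) : InjOn (blMap a C f) {x | ∀ i, ⟪a i, x⟫ ∈ V} := by
  intro x hx y hy hxy
  by_contra hne
  have h0 : ⟪blMap a C f x - blMap a C f y, x - y⟫ = 0 := by rw [hxy]; simp
  have h1 : ⟪blMap a C f x - blMap a C f y, x - y⟫ =
      ∑ i, C i * ((f ⟪a i, x⟫ - f ⟪a i, y⟫) * (⟪a i, x⟫ - ⟪a i, y⟫)) := by
    unfold blMap
    rw [← Finset.sum_sub_distrib, sum_inner]
    refine Finset.sum_congr rfl fun i _ => ?_
    rw [← sub_smul, real_inner_smul_left, inner_sub_right]; ring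
  have h2 : ∀ i, 0 ≤ (f ⟪a i, x⟫ - f ⟪a i, y⟫) * (⟪a i, x⟫ - ⟪a i, y⟫) := fun i => by
    rcases le_total ⟪a i, x⟫ ⟪a i, y⟫ with h | h
    · have := hf.monotoneOn (hx i) (hy i) h
      nlinarith
    · have := hf.monotoneOn (hy i) (hx i) h
      nlinarith
  rw [h1, Finset.sum_eq_zero_iff_of_nonneg fun i _ => mul_nonneg (hC i).le (h2 i)] at h0
  have h3 : ∀ i, ⟪a i, x - y⟫ = 0 := fun i => by
    have h4 := h0 i (Finset.mem_univ i)
    rw [inner_sub_right]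
    rcases mul_eq_zero.mp h4 with h | h
    · exact absurd h (hC i).ne'
    · rcases mul_eq_zero.mp h with h | h
      · rw [hf.injOn (hx i) (hy i) (sub_eq_zero.mp h), sub_self]
      · exact h
  have h4 := hI (x - y)
  simp only [h3] at h4
  simp at h4
  exact hne (sub_eq_zero.mp h4)

lemma norm_blSum_sq_le (a : ι → EuclideanSpace ℝ (Fin N)) (C θ : ι → ℝ) (hC : ∀ i, 0 < C i)
    (hI : ∀ x, ‖x‖ ^ 2 = ∑ i, C i * ⟪a i, x⟫ ^ 2) :
    ‖∑ i, (C i * θ i) • a i‖ ^ 2 ≤ ∑ i, C i * θ i ^ 2 := by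
  set v := ∑ i, (C i * θ i) • a i with hv
  have h1 : ‖v‖ ^ 2 = ∑ i, C i * θ i * ⟪a i, v⟫ := by
    rw [← real_inner_self_eq_norm_sq]
    nth_rewrite 1 [hv]
    rw [sum_inner]
    exact Finset.sum_congr rfl fun i _ => by rw [real_inner_smul_left]
  have h2 : ∑ i, C i * θ i * ⟪a i, v⟫ ≤ ∑ i, (C i * θ i ^ 2 / 2 + C i * ⟪a i, v⟫ ^ 2 / 2) :=
    Finset.sum_le_sum fun i _ => by
      have := mul_nonneg (hC i).le (sq_nonneg (θ i - ⟪a i, v⟫))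
      nlinarith
  rw [Finset.sum_add_distrib, ← Finset.sum_div, ← Finset.sum_div, ← hI] at h2
  linarith

/-- Standard Gaussian density on Euclidean space. -/
def gN (x : EuclideanSpace ℝ (Fin N)) : ℝ :=
  (Real.sqrt (2 * Real.pi))⁻¹ ^ N * Real.exp (-‖x‖ ^ 2 / 2)

lemma gN_nonneg (x : EuclideanSpace ℝ (Fin N)) : 0 ≤ gN x := by unfold gN; positivity

lemma continuous_gN : Continuous (gN (N := N)) := by unfold gN; fun_prop

lemma prod_stdGauss (C θ : ι → ℝ) (hCN : ∑ i, C i = N) :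
    ∏ i, stdGauss (θ i) ^ C i =
      (Real.sqrt (2 * Real.pi))⁻¹ ^ N * Real.exp (-(∑ i, C i * θ i ^ 2) / 2) := by
  have hp : 0 < (Real.sqrt (2 * Real.pi))⁻¹ := by positivity
  have h1 : ∀ i, stdGauss (θ i) ^ C i =
      (Real.sqrt (2 * Real.pi))⁻¹ ^ C i * Real.exp (-(C i * θ i ^ 2) / 2) := fun i => by
    unfold stdGauss
    rw [Real.mul_rpow hp.le (Real.exp_pos _).le, ← Real.exp_mul]
    congr 2; ring
  rw [Finset.prod_congr rfl fun i _ => h1 i, Finset.prod_mul_distrib, ← Real.exp_sum,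
    ← Real.rpow_sum_of_pos hp, hCN, Real.rpow_natCast, ← Finset.sum_div, Finset.sum_neg_distrib]

lemma prod_stdGauss_le (a : ι → EuclideanSpace ℝ (Fin N)) (C θ : ι → ℝ) (hC : ∀ i, 0 < C i)
    (hI : ∀ x, ‖x‖ ^ 2 = ∑ i, C i * ⟪a i, x⟫ ^ 2) (hCN : ∑ i, C i = N) :
    ∏ i, stdGauss (θ i) ^ C i ≤ gN (∑ i, (C i * θ i) • a i) := by
  rw [prod_stdGauss C θ hCN]
  unfold gN
  apply mul_le_mul_of_nonneg_left _ (by positivity)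
  apply Real.exp_le_exp.mpr
  have := norm_blSum_sq_le a C θ hC hI
  linarith

lemma prod_stdGauss_eq (a : ι → EuclideanSpace ℝ (Fin N)) (C : ι → ℝ)
    (hI : ∀ x, ‖x‖ ^ 2 = ∑ i, C i * ⟪a i, x⟫ ^ 2) (hCN : ∑ i, C i = N)
    (x : EuclideanSpace ℝ (Fin N)) :
    ∏ i, stdGauss ⟪a i, x⟫ ^ C i = gN x := by
  rw [prod_stdGauss C _ hCN, ← hI]; rfl

lemma integral_gN : ∫ x : EuclideanSpace ℝ (Fin N), gN x = 1 := by
  unfold gN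
  rw [integral_const_mul]
  have h := GaussianFourier.integral_rexp_neg_mul_sq_norm (V := EuclideanSpace ℝ (Fin N))
    (b := 1 / 2) (by norm_num)
  have e : ∀ v : EuclideanSpace ℝ (Fin N), -‖v‖ ^ 2 / 2 = -(1 / 2) * ‖v‖ ^ 2 := fun v => by ring
  simp only [e]
  rw [h, finrank_euclideanSpace_fin]
  have e2 : Real.pi / (1 / 2) = 2 * Real.pi := by ring
  have hp : 0 < 2 * Real.pi := by positivity
  rw [e2, inv_pow, Real.sqrt_eq_rpow, ← Real.rpow_natCast, ← Real.rpow_mul hp.le]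
  have e3 : 1 / 2 * (N : ℝ) = N / 2 := by ring
  rw [e3]
  exact inv_mul_cancel₀ (by positivity)

lemma lintegral_gN : ∫⁻ x : EuclideanSpace ℝ (Fin N), ENNReal.ofReal (gN x) = 1 := by
  rw [← ofReal_integral_eq_lintegral_ofReal _ (Filter.Eventually.of_forall gN_nonneg),
    integral_gN, ENNReal.ofReal_one]
  by_contra h
  have := integral_gN (N := N)
  rw [integral_undef h] at this
  norm_num at this

lemma volume_ball_ge (hN : 2 ≤ N) (z : EuclideanSpace ℝ (Fin N)) {r : ℝ} (hr : 0 < r) :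
    ENNReal.ofReal ((r / N) ^ N) ≤ volume (ball z r) := by
  have : Nonempty (Fin N) := ⟨⟨0, by omega⟩⟩
  have hN0 : (0 : ℝ) < N := by positivity
  have hN2 : (2 : ℝ) ≤ N := by exact_mod_cast hN
  rw [EuclideanSpace.volume_ball, Fintype.card_fin, ← ENNReal.ofReal_pow hr.le,
    ← ENNReal.ofReal_mul (by positivity)]
  apply ENNReal.ofReal_le_ofReal
  rw [div_pow, div_eq_mul_inv]
  apply mul_le_mul_of_nonneg_left _ (by positivity)
  have hG : 0 < Real.Gamma ((N : ℝ) / 2 + 1) := Real.Gamma_pos_of_pos (by positivity)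
  rw [inv_eq_one_div, div_le_div_iff₀ (by positivity) hG]
  have h1 : Real.Gamma ((N : ℝ) / 2 + 1) ≤ (N : ℝ) ^ N := by
    have h2 : Real.Gamma ((N : ℝ) / 2 + 1) ≤ Real.Gamma ((N : ℝ) + 1) :=
      Real.Gamma_strictMonoOn_Ici.monotoneOn (by simp; linarith) (by simp; linarith) (by linarith)
    rw [Real.Gamma_nat_eq_factorial] at h2
    refine h2.trans ?_
    exact_mod_cast Nat.factorial_le_pow N
  have h2 : 1 ≤ Real.sqrt Real.pi ^ N := by
    apply one_le_pow₀
    rw [Real.one_le_sqrt]; linarith [Real.pi_gt_three]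
  have : 0 < (N : ℝ) ^ N := by positivity
  nlinarith

/-- Final integration over a small ball. -/
lemma ball_final (hN : 2 ≤ N) (a : ι → EuclideanSpace ℝ (Fin N)) (C : ι → ℝ)
    (ha : ∀ i, ‖a i‖ = 1) (x0 : EuclideanSpace ℝ (Fin N)) (α : ℝ) (hx0 : ∀ i, ⟪a i, x0⟫ = α)
    (i j : ι) (D : EuclideanSpace ℝ (Fin N) → ℝ) (ε : ℝ) (hε : 0 < ε)
    (hD : ∀ x, (∀ i, |⟪a i, x⟫ - α| ≤ 1 / 32) →
      (1 / 5) ^ N * (C i * C j * ⟪a i, a j⟫ ^ 2 * (⟪a i, x⟫ - ⟪a j, x⟫) ^ 2 / 2 ^ 22) ≤ D x)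
    (hInt : ∫⁻ x in closedBall x0 (1 / 32), ENNReal.ofReal (D x) ≤ ENNReal.ofReal ε)
    (hCi : 0 < C i) (hCj : 0 < C j) :
    C i * C j * ⟪a i, a j⟫ ^ 2 * ‖a i - a j‖ ^ 2 ≤ 2 ^ 36 * (640 * N) ^ N * ε := by
  have hN0 : (0 : ℝ) < N := by positivity
  by_cases hd : a i - a j = 0
  · rw [hd]; simp; positivity
  set d := a i - a j with hdd
  have hdn : 0 < ‖d‖ := norm_pos_iff.mpr hd
  set z := x0 + ((1 / 64) * ‖d‖⁻¹) • d with hz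
  have hzx : ‖z - x0‖ = 1 / 64 := by
    rw [hz, add_sub_cancel_left, norm_smul, Real.norm_of_nonneg (by positivity)]
    field_simp
  set c := (1 / 5 : ℝ) ^ N * (C i * C j * ⟪a i, a j⟫ ^ 2 * (‖d‖ / 128) ^ 2 / 2 ^ 22) with hc
  have hsub : ball z (1 / 128) ⊆ closedBall x0 (1 / 32) := by
    intro x hx
    rw [mem_ball, dist_eq_norm] at hx
    rw [mem_closedBall, dist_eq_norm]
    calc ‖x - x0‖ = ‖(x - z) + (z - x0)‖ := by congr 1; abel
      _ ≤ ‖x - z‖ + ‖z - x0‖ := norm_add_le _ _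
      _ ≤ 1 / 32 := by rw [hzx]; linarith
  have hpt : ∀ x ∈ ball z (1 / 128), ENNReal.ofReal c ≤ ENNReal.ofReal (D x) := by
    intro x hx
    apply ENNReal.ofReal_le_ofReal
    have hx1 := hsub hx
    rw [mem_closedBall, dist_eq_norm] at hx1
    refine le_trans ?_ (hD x fun k => ?_)
    · rw [hc]
      apply mul_le_mul_of_nonneg_left _ (by positivity)
      apply div_le_div_of_nonneg_right _ (by positivity)
      apply mul_le_mul_of_nonneg_left _ (by positivity)
      apply pow_le_pow_left₀ (by positivity)
      rw [← inner_sub_left, ← hdd]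
      have e1 : x = x0 + ((1 / 64) * ‖d‖⁻¹) • d + (x - z) := by rw [← hz]; abel
      rw [e1, inner_add_right, inner_add_right, real_inner_smul_right,
        real_inner_self_eq_norm_sq]
      have e2 : ⟪d, x0⟫ = 0 := by rw [hdd, inner_sub_left, hx0, hx0, sub_self]
      have e3 : |⟪d, x - z⟫| ≤ ‖d‖ * ‖x - z‖ := abs_real_inner_le_norm _ _
      rw [mem_ball, dist_eq_norm] at hx
      have e4 : 1 / 64 * ‖d‖⁻¹ * ‖d‖ ^ 2 = ‖d‖ / 64 := by field_simp
      rw [e2, e4]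
      have := neg_abs_le ⟪d, x - z⟫
      nlinarith
    · rw [← hx0 k, ← inner_sub_right]
      refine (abs_real_inner_le_norm _ _).trans ?_
      rw [ha, one_mul]; exact hx1
  have h1 : ENNReal.ofReal c * volume (ball z (1 / 128)) ≤ ENNReal.ofReal ε := by
    refine le_trans ?_ hInt
    refine le_trans ?_ (lintegral_mono_set hsub)
    rw [← setLIntegral_const]
    exact setLIntegral_mono' measurableSet_ball hpt
  have h2 : ENNReal.ofReal (c * ((1 / 128) / N) ^ N) ≤ ENNReal.ofReal ε := by
    rw [ENNReal.ofReal_mul (by positivity)]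
    refine le_trans ?_ h1
    gcongr
    exact volume_ball_ge hN z (by norm_num)
  rw [ENNReal.ofReal_le_ofReal_iff hε.le] at h2
  have e5 : C i * C j * ⟪a i, a j⟫ ^ 2 * ‖d‖ ^ 2 =
      2 ^ 36 * (640 * N) ^ N * (c * ((1 / 128) / N) ^ N) := by
    have : ((640 * N : ℝ)) ^ N * ((1 / 5) ^ N * ((1 / 128) / N) ^ N) = 1 := by
      rw [← mul_pow, ← mul_pow]
      have : (640 * N : ℝ) * (1 / 5 * (1 / 128 / N)) = 1 := by field_simp; norm_num
      rw [this, one_pow]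
    rw [hc]
    calc C i * C j * ⟪a i, a j⟫ ^ 2 * ‖d‖ ^ 2
        = C i * C j * ⟪a i, a j⟫ ^ 2 * ‖d‖ ^ 2 *
          (((640 * N : ℝ)) ^ N * ((1 / 5) ^ N * ((1 / 128) / N) ^ N)) := by rw [this, mul_one]
      _ = _ := by ring
  rw [e5]
  exact mul_le_mul_of_nonneg_left h2 (by positivity)

end transport

section cases
variable {N : ℕ} {ι : Type*} [Fintype ι]

lemma prod_rpow_ge (C v : ι → ℝ) (hC : ∀ i, 0 < C i) (hCN : ∑ i, C i = N)
    (hv : ∀ i, 1 / 5 ≤ v i) : (1 / 5 : ℝ) ^ N ≤ ∏ i, v i ^ C i := by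
  have h : (1 / 5 : ℝ) ^ N = ∏ i, (1 / 5 : ℝ) ^ C i := by
    rw [← Real.rpow_sum_of_pos (by norm_num), hCN, Real.rpow_natCast]
  rw [h]
  exact Finset.prod_le_prod (fun i _ => by positivity) fun i _ =>
    Real.rpow_le_rpow (by norm_num) (hv i) (hC i).le

lemma double_sum_ge (f : ι → ι → ℝ) (hf : ∀ i j, 0 ≤ f i j) (i j : ι) :
    f i j ≤ ∑ i, ∑ j, f i j :=
  (Finset.single_le_sum (f := fun j => f i j) (fun k _ => hf i k) (Finset.mem_univ j)).trans
    (Finset.single_le_sum (f := fun i => ∑ j, f i j)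
      (fun k _ => Finset.sum_nonneg fun l _ => hf k l) (Finset.mem_univ i))

/-- The quadratic deficit. -/
def quadDef (a : ι → EuclideanSpace ℝ (Fin N)) (C : ι → ℝ) (f' : ℝ → ℝ) (M : ℝ)
    (x : EuclideanSpace ℝ (Fin N)) : ℝ :=
  1 / (8 * M ^ 2) *
    ∑ i, ∑ j, C i * C j * ⟪a i, a j⟫ ^ 2 * (f' ⟪a i, x⟫ - f' ⟪a j, x⟫) ^ 2

lemma quadDef_nonneg (a : ι → EuclideanSpace ℝ (Fin N)) (C : ι → ℝ) (hC : ∀ i, 0 < C i)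
    (f' : ℝ → ℝ) (M : ℝ) (x : EuclideanSpace ℝ (Fin N)) : 0 ≤ quadDef a C f' M x := by
  unfold quadDef
  apply mul_nonneg (by positivity)
  refine Finset.sum_nonneg fun i _ => Finset.sum_nonneg fun j _ => ?_
  have := hC i; have := hC j
  positivity

lemma quadDef_ge (a : ι → EuclideanSpace ℝ (Fin N)) (C : ι → ℝ) (hC : ∀ i, 0 < C i)
    (f' : ℝ → ℝ) (M κ : ℝ) (hM : 0 < M) (hκ : 0 < κ) (hMκ : 8 * M ^ 2 ≤ 2 ^ 22 * κ ^ 2)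
    (x : EuclideanSpace ℝ (Fin N)) (i j : ι)
    (h : κ * |⟪a i, x⟫ - ⟪a j, x⟫| ≤ |f' ⟪a i, x⟫ - f' ⟪a j, x⟫|) :
    C i * C j * ⟪a i, a j⟫ ^ 2 * (⟪a i, x⟫ - ⟪a j, x⟫) ^ 2 / 2 ^ 22 ≤ quadDef a C f' M x := by
  have hi := hC i
  have hj := hC j
  have h1 := double_sum_ge
    (fun i j => C i * C j * ⟪a i, a j⟫ ^ 2 * (f' ⟪a i, x⟫ - f' ⟪a j, x⟫) ^ 2)
    (fun i j => by have := hC i; have := hC j; positivity) i j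
  have h2 : κ ^ 2 * (⟪a i, x⟫ - ⟪a j, x⟫) ^ 2 ≤ (f' ⟪a i, x⟫ - f' ⟪a j, x⟫) ^ 2 := by
    have := pow_le_pow_left₀ (by positivity) h 2
    rwa [mul_pow, sq_abs, sq_abs] at this
  unfold quadDef
  refine le_trans ?_ (mul_le_mul_of_nonneg_left h1 (by positivity))
  set P := C i * C j * ⟪a i, a j⟫ ^ 2
  have hP : 0 ≤ P := by positivity
  rw [div_le_iff₀ (by positivity)]
  have h5 : ∀ X : ℝ, 1 / (8 * M ^ 2) * X * 2 ^ 22 = (X * 2 ^ 22) / (8 * M ^ 2) := fun X => by ring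
  rw [h5, le_div_iff₀ (by positivity)]
  have h3 : 0 ≤ P * (⟪a i, x⟫ - ⟪a j, x⟫) ^ 2 := by positivity
  have h4 := mul_le_mul_of_nonneg_left h2 hP
  nlinarith

lemma case_rev (hN : 2 ≤ N) (a : ι → EuclideanSpace ℝ (Fin N)) (C : ι → ℝ) (hC : ∀ i, 0 < C i)
    (ha : ∀ i, ‖a i‖ = 1) (hI : ∀ x, ‖x‖ ^ 2 = ∑ i, C i * ⟪a i, x⟫ ^ 2) (hCN : ∑ i, C i = N)
    (s : ℝ) (hs : 0 ≤ s) (hs' : s ≤ 0.15) (ε : ℝ) (hε : 0 < ε)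
    (x0 : EuclideanSpace ℝ (Fin N)) (hx0 : ∀ i, ⟪a i, x0⟫ = -3 / 4)
    (h : upperIntegral volume
          (fun x => ⨆ (θ : ι → ℝ) (_ : x = ∑ i, (C i * θ i) • a i),
            ENNReal.ofReal (∏ i, truncGauss s (θ i) ^ C i)) ≤ ENNReal.ofReal (1 + ε)) (i j : ι) :
    C i * C j * ⟪a i, a j⟫ ^ 2 * ‖a i - a j‖ ^ 2 ≤ 2 ^ 36 * (640 * N) ^ N * ε := by
  set D : EuclideanSpace ℝ (Fin N) → ℝ := fun x => gN x * quadDef a C (trS' s) 8 x with hD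
  have hrange : ∀ x, (∀ i, |⟪a i, x⟫ - (-3 / 4)| ≤ 1 / 32) →
      ∀ i, -25 / 32 ≤ ⟪a i, x⟫ ∧ ⟪a i, x⟫ ≤ -23 / 32 := fun x hx i => by
    have := abs_le.mp (hx i)
    constructor <;> linarith [this.1, this.2]
  refine ball_final hN a C ha x0 (-3 / 4) hx0 i j D ε hε ?_ ?_ (hC i) (hC j)
  · intro x hx
    have hr := hrange x hx
    apply mul_le_mul
    · rw [← prod_stdGauss_eq a C hI hCN]
      apply prod_rpow_ge C _ hC hCN
      intro i
      have := stdGauss_ge (x := ⟪a i, x⟫) (r := 25 / 32) (by nlinarith [(hr i).1, (hr i).2])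
      norm_num at this ⊢; linarith
    · apply quadDef_ge a C hC _ 8 0.05 (by norm_num) (by norm_num) (by norm_num)
      rcases le_total ⟪a i, x⟫ ⟪a j, x⟫ with h1 | h1
      · have := trS'_growth hs hs' (by linarith [(hr i).1]) h1 (by linarith [(hr j).2])
        rw [abs_sub_comm, abs_of_nonneg (sub_nonneg.mpr h1), abs_sub_comm]
        exact this.trans (le_abs_self _)
      · have := trS'_growth hs hs' (by linarith [(hr j).1]) h1 (by linarith [(hr i).2])
        rw [abs_of_nonneg (sub_nonneg.mpr h1)]
        exact this.trans (le_abs_self _)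
    · have := hC i; have := hC j
      positivity
    · exact gN_nonneg x
  · set B := closedBall x0 (1 / 32 : ℝ) with hB
    have key : 1 + ∫⁻ x in B, ENNReal.ofReal (D x) ≤ ENNReal.ofReal (1 + ε) := by
      refine le_trans ?_ h
      refine le_iInf fun g => le_iInf fun hg => le_iInf fun hfg => ?_
      have hmono : StrictMonoOn (trS s) univ := by
        rw [strictMonoOn_univ]
        exact strictMono_of_hasDerivAt_pos (hasDerivAt_trS s) (trS'_pos s)
      have hinj : InjOn (blMap a C (trS s)) univ := by
        have := injOn_blMap a C hC hI (trS s) univ hmono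
        simpa using this
      have hder : ∀ x ∈ (univ : Set (EuclideanSpace ℝ (Fin N))),
          HasFDerivWithinAt (blMap a C (trS s)) (blD a C (trS' s) x) univ x := fun x _ =>
        (hasFDerivAt_blMap a C _ _ x fun i => hasDerivAt_trS s _).hasFDerivWithinAt
      have hcv := lintegral_image_eq_lintegral_abs_det_fderiv_mul volume MeasurableSet.univ
        hder hinj g
      have hge : ∀ x, ENNReal.ofReal (∏ i, truncGauss s (trS s ⟪a i, x⟫) ^ C i)
          ≤ g (blMap a C (trS s) x) := fun x => by
        refine le_trans ?_ (hfg _)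
        exact le_iSup₂_of_le (fun i => trS s ⟪a i, x⟫) rfl le_rfl
      have hprod : ∀ x, (∏ i, trS' s ⟪a i, x⟫ ^ C i) *
          (∏ i, truncGauss s (trS s ⟪a i, x⟫) ^ C i) = gN x := fun x => by
        rw [← prod_stdGauss_eq a C hI hCN, ← Finset.prod_mul_distrib]
        refine Finset.prod_congr rfl fun i _ => ?_
        rw [← Real.mul_rpow (trS'_pos s _).le (truncGauss_nonneg _ _), mul_comm,
          truncGauss_trS]
      have hP0 : ∀ x, 0 ≤ ∏ i, truncGauss s (trS s ⟪a i, x⟫) ^ C i := fun x =>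
        Finset.prod_nonneg fun i _ => Real.rpow_nonneg (truncGauss_nonneg _ _) _
      set F : EuclideanSpace ℝ (Fin N) → ℝ≥0∞ := fun x =>
        ENNReal.ofReal |(blD a C (trS' s) x).det| * g (blMap a C (trS s) x) with hF
      have hF1 : ∀ x, ENNReal.ofReal (gN x) ≤ F x := fun x => by
        have hdet := det_ineq' a C (fun i => trS' s ⟪a i, x⟫) hC ha hI (fun i => trS'_pos s _)
          (blD a C (trS' s) x) (blD_apply a C (trS' s) x)
        rw [← hprod, ENNReal.ofReal_mul (Finset.prod_nonneg fun i _ =>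
          Real.rpow_nonneg (trS'_pos s _).le _)]
        exact mul_le_mul' (ENNReal.ofReal_le_ofReal (hdet.trans (le_abs_self _))) (hge x)
      have hF2 : ∀ x ∈ B, ENNReal.ofReal (gN x) + ENNReal.ofReal (D x) ≤ F x := fun x hx => by
        have hr := hrange x (fun i => by
          rw [← hx0 i, ← inner_sub_right]
          refine (abs_real_inner_le_norm _ _).trans ?_
          rw [ha, one_mul, ← dist_eq_norm]; exact hx)
        have hdet := det_ineq a C (fun i => trS' s ⟪a i, x⟫) hC ha hI (fun i => trS'_pos s _)
          (blD a C (trS' s) x) (blD_apply a C (trS' s) x) 8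
          (fun i => trS'_le hs hs' (by linarith [(hr i).2]))
        have hq := quadDef_nonneg a C hC (trS' s) 8 x
        rw [← ENNReal.ofReal_add (gN_nonneg x) (mul_nonneg (gN_nonneg x) hq)]
        have e : gN x + D x = ((∏ i, trS' s ⟪a i, x⟫ ^ C i) * (1 + quadDef a C (trS' s) 8 x)) *
            (∏ i, truncGauss s (trS s ⟪a i, x⟫) ^ C i) := by
          rw [hD]; simp only []; rw [← hprod]; ring
        rw [e, ENNReal.ofReal_mul (mul_nonneg (Finset.prod_nonneg fun i _ =>
          Real.rpow_nonneg (trS'_pos s _).le _) (by linarith))]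
        exact mul_le_mul' (ENNReal.ofReal_le_ofReal (hdet.trans (le_abs_self _))) (hge x)
      have hgm : Measurable fun x : EuclideanSpace ℝ (Fin N) => ENNReal.ofReal (gN x) :=
        continuous_gN.measurable.ennreal_ofReal
      have hBm : MeasurableSet B := isClosed_closedBall.measurableSet
      calc 1 + ∫⁻ x in B, ENNReal.ofReal (D x)
          = ((∫⁻ x in B, ENNReal.ofReal (gN x)) + ∫⁻ x in Bᶜ, ENNReal.ofReal (gN x))
            + ∫⁻ x in B, ENNReal.ofReal (D x) := by
            rw [lintegral_add_compl _ hBm, lintegral_gN]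
        _ = (∫⁻ x in B, (ENNReal.ofReal (gN x) + ENNReal.ofReal (D x)))
            + ∫⁻ x in Bᶜ, ENNReal.ofReal (gN x) := by
            rw [lintegral_add_left hgm]; ring
        _ ≤ (∫⁻ x in B, F x) + ∫⁻ x in Bᶜ, F x :=
            add_le_add (setLIntegral_mono' hBm hF2) (lintegral_mono hF1)
        _ = ∫⁻ x, F x := lintegral_add_compl _ hBm
        _ = ∫⁻ x in Set.image (blMap a C (trS s)) univ, g x := by rw [hcv, Measure.restrict_univ]
        _ ≤ ∫⁻ x, g x := setLIntegral_le_lintegral _ _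
    rw [ENNReal.ofReal_add zero_le_one hε.le, ENNReal.ofReal_one] at key
    exact (ENNReal.add_le_add_iff_left ENNReal.one_ne_top).mp key

lemma measurable_truncGauss (s : ℝ) : Measurable (truncGauss s) := by
  unfold truncGauss
  refine Measurable.ite measurableSet_Ici ?_ measurable_const
  exact ((continuous_stdGauss.measurable.comp (measurable_id.sub_const s))).div_const _

lemma case_fwd (hN : 2 ≤ N) (a : ι → EuclideanSpace ℝ (Fin N)) (C : ι → ℝ) (hC : ∀ i, 0 < C i)
    (ha : ∀ i, ‖a i‖ = 1) (hI : ∀ x, ‖x‖ ^ 2 = ∑ i, C i * ⟪a i, x⟫ ^ 2) (hCN : ∑ i, C i = N)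
    (s : ℝ) (hs : 0 ≤ s) (hs' : s ≤ 0.15) (ε : ℝ) (hε : 0 < ε) (hε1 : ε < 1)
    (x0 : EuclideanSpace ℝ (Fin N)) (hx0 : ∀ i, ⟪a i, x0⟫ = 3 / 32)
    (h : 1 - ε ≤ ∫ x, ∏ i, truncGauss s ⟪x, a i⟫ ^ C i) (i j : ι) :
    C i * C j * ⟪a i, a j⟫ ^ 2 * ‖a i - a j‖ ^ 2 ≤ 2 ^ 36 * (640 * N) ^ N * ε := by
  set P : EuclideanSpace ℝ (Fin N) → ℝ := fun x => ∏ i, truncGauss s ⟪a i, x⟫ ^ C i with hP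
  have hPr : ∀ x : EuclideanSpace ℝ (Fin N), ∏ i, truncGauss s ⟪x, a i⟫ ^ C i = P x := fun x =>
    Finset.prod_congr rfl fun i _ => by rw [real_inner_comm]
  simp only [hPr] at h
  have hP0 : ∀ x, 0 ≤ P x := fun x =>
    Finset.prod_nonneg fun i _ => Real.rpow_nonneg (truncGauss_nonneg _ _) _
  have hPm : Measurable P := by
    refine Finset.measurable_prod _ fun i _ => ?_
    refine Measurable.pow_const ?_ _
    exact (measurable_truncGauss s).comp (innerSL ℝ (a i)).continuous.measurable
  set D : EuclideanSpace ℝ (Fin N) → ℝ := fun x => P x * quadDef a C (trT' s) 200 x with hD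
  have hrange : ∀ x, (∀ i, |⟪a i, x⟫ - 3 / 32| ≤ 1 / 32) →
      ∀ i, 1 / 16 ≤ ⟪a i, x⟫ ∧ ⟪a i, x⟫ ≤ 1 / 8 := fun x hx i => by
    have := abs_le.mp (hx i)
    constructor <;> linarith [this.1, this.2]
  refine ball_final hN a C ha x0 (3 / 32) hx0 i j D ε hε ?_ ?_ (hC i) (hC j)
  · intro x hx
    have hr := hrange x hx
    apply mul_le_mul
    · apply prod_rpow_ge C _ hC hCN
      intro i
      rw [truncGauss_of_nonneg (by linarith [(hr i).1]), le_div_iff₀ (gZ_pos s)]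
      have := stdGauss_ge (x := ⟪a i, x⟫ - s) (r := 25 / 32) (by nlinarith [(hr i).1, (hr i).2])
      have := gZ_lt s
      norm_num at this ⊢; linarith
    · apply quadDef_ge a C hC _ 200 0.3 (by norm_num) (by norm_num) (by norm_num)
      rcases le_total ⟪a i, x⟫ ⟪a j, x⟫ with h1 | h1
      · have := trT'_growth hs hs' (by linarith [(hr i).1]) h1 (by linarith [(hr j).2])
        rw [abs_sub_comm, abs_of_nonneg (sub_nonneg.mpr h1)]
        exact this.trans (le_abs_self _)
      · have := trT'_growth hs hs' (by linarith [(hr j).1]) h1 (by linarith [(hr i).2])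
        rw [abs_of_nonneg (sub_nonneg.mpr h1), abs_sub_comm]
        exact this.trans (le_abs_self _)
    · have := hC i; have := hC j
      positivity
    · exact hP0 x
  · set B := closedBall x0 (1 / 32 : ℝ) with hB
    have hBm : MeasurableSet B := isClosed_closedBall.measurableSet
    set U : Set (EuclideanSpace ℝ (Fin N)) := {x | ∀ i, ⟪a i, x⟫ ∈ Ioi (0 : ℝ)} with hU
    have hUm : MeasurableSet U := by
      have : U = ⋂ i, (innerSL ℝ (a i)) ⁻¹' Ioi 0 := by ext x; simp [hU]
      rw [this]
      exact MeasurableSet.iInter fun i => (innerSL ℝ (a i)).continuous.measurable measurableSet_Ioi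
    have hBr : ∀ x ∈ B, ∀ i, 1 / 16 ≤ ⟪a i, x⟫ ∧ ⟪a i, x⟫ ≤ 1 / 8 := fun x hx =>
      hrange x (fun i => by
          rw [← hx0 i, ← inner_sub_right]
          refine (abs_real_inner_le_norm _ _).trans ?_
          rw [ha, one_mul, ← dist_eq_norm]; exact hx)
    have hBU : B ⊆ U := fun x hx i => by
      have := (hBr x hx i).1
      show (0 : ℝ) < _
      linarith
    have hmono : StrictMonoOn (trT s) (Ioi 0) := by
      apply strictMonoOn_of_deriv_pos (convex_Ioi 0)
      · exact fun x hx => (hasDerivAt_trT hx).continuousAt.continuousWithinAt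
      · intro x hx
        rw [interior_Ioi] at hx
        rw [(hasDerivAt_trT hx).deriv]; exact trT'_pos s x
    have hinj : InjOn (blMap a C (trT s)) U := injOn_blMap a C hC hI (trT s) (Ioi 0) hmono
    have hder : ∀ x ∈ U, HasFDerivWithinAt (blMap a C (trT s)) (blD a C (trT' s) x) U x :=
      fun x hx => (hasFDerivAt_blMap a C _ _ x fun i => hasDerivAt_trT (hx i)).hasFDerivWithinAt
    have hcv := lintegral_image_eq_lintegral_abs_det_fderiv_mul volume hUm hder hinj
      (fun x => ENNReal.ofReal (gN x))
    have hprod : ∀ x ∈ U, (∏ i, trT' s ⟪a i, x⟫ ^ C i) *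
        (∏ i, stdGauss (trT s ⟪a i, x⟫) ^ C i) = P x := fun x hx => by
      rw [hP, ← Finset.prod_mul_distrib]
      refine Finset.prod_congr rfl fun i _ => ?_
      rw [← Real.mul_rpow (trT'_pos s _).le (stdGauss_pos _).le, mul_comm,
        truncGauss_trT (hx i)]
    have hgp : ∀ x, ∏ i, stdGauss (trT s ⟪a i, x⟫) ^ C i ≤ gN (blMap a C (trT s) x) := fun x =>
      prod_stdGauss_le a C (fun i => trT s ⟪a i, x⟫) hC hI hCN
    have hgp0 : ∀ x, 0 ≤ ∏ i, stdGauss (trT s ⟪a i, x⟫) ^ C i := fun x =>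
      Finset.prod_nonneg fun i _ => Real.rpow_nonneg (stdGauss_pos _).le _
    set F : EuclideanSpace ℝ (Fin N) → ℝ≥0∞ := fun x =>
      ENNReal.ofReal |(blD a C (trT' s) x).det| * ENNReal.ofReal (gN (blMap a C (trT s) x)) with hF
    have hF1 : ∀ x ∈ U, ENNReal.ofReal (P x) ≤ F x := fun x hx => by
      have hdet := det_ineq' a C (fun i => trT' s ⟪a i, x⟫) hC ha hI (fun i => trT'_pos s _)
        (blD a C (trT' s) x) (blD_apply a C (trT' s) x)
      rw [← hprod x hx, ENNReal.ofReal_mul (Finset.prod_nonneg fun i _ =>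
        Real.rpow_nonneg (trT'_pos s _).le _)]
      exact mul_le_mul' (ENNReal.ofReal_le_ofReal (hdet.trans (le_abs_self _)))
        (ENNReal.ofReal_le_ofReal (hgp x))
    have hF2 : ∀ x ∈ B, ENNReal.ofReal (P x) + ENNReal.ofReal (D x) ≤ F x := fun x hx => by
      have hr := hBr x hx
      have hdet := det_ineq a C (fun i => trT' s ⟪a i, x⟫) hC ha hI (fun i => trT'_pos s _)
        (blD a C (trT' s) x) (blD_apply a C (trT' s) x) 200
        (fun i => trT'_le hs hs' (hr i).1 (hr i).2)
      have hq := quadDef_nonneg a C hC (trT' s) 200 x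
      rw [← ENNReal.ofReal_add (hP0 x) (mul_nonneg (hP0 x) hq)]
      have e : P x + D x = ((∏ i, trT' s ⟪a i, x⟫ ^ C i) * (1 + quadDef a C (trT' s) 200 x)) *
          (∏ i, stdGauss (trT s ⟪a i, x⟫) ^ C i) := by
        rw [hD]; simp only []; rw [← hprod x (hBU hx)]; ring
      rw [e, ENNReal.ofReal_mul (mul_nonneg (Finset.prod_nonneg fun i _ =>
        Real.rpow_nonneg (trT'_pos s _).le _) (by linarith))]
      exact mul_le_mul' (ENNReal.ofReal_le_ofReal (hdet.trans (le_abs_self _)))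
        (ENNReal.ofReal_le_ofReal (hgp x))
    have hPU : ∫⁻ x, ENNReal.ofReal (P x) = ∫⁻ x in U, ENNReal.ofReal (P x) := by
      rw [← lintegral_indicator hUm]
      apply lintegral_congr_ae
      have hnull : ∀ i, ∀ᵐ x : EuclideanSpace ℝ (Fin N), ⟪a i, x⟫ ≠ 0 := fun i => by
        have hne : LinearMap.ker (innerSL ℝ (a i) : EuclideanSpace ℝ (Fin N) →ₗ[ℝ] ℝ) ≠ ⊤ := by
          intro htop
          have : a i ∈ LinearMap.ker (innerSL ℝ (a i) : EuclideanSpace ℝ (Fin N) →ₗ[ℝ] ℝ) := by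
            rw [htop]; trivial
          rw [LinearMap.mem_ker] at this
          have h1 : ⟪a i, a i⟫ = 0 := this
          rw [real_inner_self_eq_norm_sq, ha] at h1
          norm_num at h1
        have := Measure.addHaar_submodule volume _ hne
        rw [ae_iff]
        convert this using 2
        ext x; simp
      filter_upwards [ae_all_iff.mpr hnull] with x hx
      by_cases hxU : x ∈ U
      · rw [indicator_of_mem hxU]
      · rw [indicator_of_notMem hxU]
        have : ∃ i, ⟪a i, x⟫ < 0 := by
          by_contra hcon
          push Not at hcon
          exact hxU fun i => lt_of_le_of_ne (hcon i) (hx i).symm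
        obtain ⟨i, hi⟩ := this
        have : P x = 0 := by
          apply Finset.prod_eq_zero (Finset.mem_univ i)
          unfold truncGauss
          rw [if_neg (not_le.mpr hi), Real.zero_rpow (hC i).ne']
        rw [this, ENNReal.ofReal_zero]
    have hlow : ENNReal.ofReal (1 - ε) ≤ ∫⁻ x, ENNReal.ofReal (P x) := by
      rw [integral_eq_lintegral_of_nonneg_ae (Filter.Eventually.of_forall hP0)
        hPm.aestronglyMeasurable] at h
      exact (ENNReal.ofReal_le_ofReal h).trans ENNReal.ofReal_toReal_le
    have hUB : MeasurableSet (U \ B) := hUm.diff hBm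
    have split : ∀ f : EuclideanSpace ℝ (Fin N) → ℝ≥0∞,
        ∫⁻ x in U, f x = (∫⁻ x in B, f x) + ∫⁻ x in U \ B, f x := fun f => by
      rw [← lintegral_union hUB disjoint_sdiff_right, union_diff_cancel hBU]
    have key : ENNReal.ofReal (1 - ε) + ∫⁻ x in B, ENNReal.ofReal (D x) ≤ 1 := by
      calc ENNReal.ofReal (1 - ε) + ∫⁻ x in B, ENNReal.ofReal (D x)
          ≤ ((∫⁻ x in B, ENNReal.ofReal (P x)) + ∫⁻ x in U \ B, ENNReal.ofReal (P x))
            + ∫⁻ x in B, ENNReal.ofReal (D x) := by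
            rw [← split, ← hPU]; gcongr
        _ = (∫⁻ x in B, (ENNReal.ofReal (P x) + ENNReal.ofReal (D x)))
            + ∫⁻ x in U \ B, ENNReal.ofReal (P x) := by
            rw [lintegral_add_left hPm.ennreal_ofReal]; ring
        _ ≤ (∫⁻ x in B, F x) + ∫⁻ x in U \ B, F x :=
            add_le_add (setLIntegral_mono' hBm hF2)
              (setLIntegral_mono' hUB fun x hx => hF1 x hx.1)
        _ = ∫⁻ x in U, F x := (split F).symm
        _ = ∫⁻ x in Set.image (blMap a C (trT s)) U, ENNReal.ofReal (gN x) := hcv.symm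
        _ ≤ ∫⁻ x, ENNReal.ofReal (gN x) := setLIntegral_le_lintegral _ _
        _ = 1 := lintegral_gN
    have e1 : (1 : ℝ≥0∞) = ENNReal.ofReal (1 - ε) + ENNReal.ofReal ε := by
      rw [← ENNReal.ofReal_add (by linarith) hε.le]; simp
    rw [e1] at key
    exact (ENNReal.add_le_add_iff_left ENNReal.ofReal_ne_top).mp key

end cases


lemma gs_close {V : Type*} [NormedAddCommGroup V] [InnerProductSpace ℝ V] (N : ℕ) (hN : 1 ≤ N)
    (a : ℕ → V) (β : ℝ) (hβ : 0 ≤ β) (hs : (2 * N : ℝ) ^ N * β ≤ 1)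
    (ha : ∀ i < N, ‖a i‖ = 1) (hab : ∀ i < N, ∀ j < N, i ≠ j → |⟪a i, a j⟫| ≤ β) :
    ∀ m ≤ N, ∃ b : ℕ → V, (∀ i < m, ‖b i‖ = 1) ∧
      (∀ i < m, ∀ j < m, i ≠ j → ⟪b i, b j⟫ = 0) ∧
      ∀ i < m, ‖a i - b i‖ ≤ ((2 * N : ℝ) ^ m - 1) * β := by
  intro m
  induction m with
  | zero => intro _; exact ⟨a, by simp, by simp, by simp⟩
  | succ m ih =>
    intro hm
    obtain ⟨b, hb1, hb2, hb3⟩ := ih (by omega)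
    have hN1 : (1 : ℝ) ≤ N := by exact_mod_cast hN
    have hmN : (m : ℝ) + 1 ≤ N := by exact_mod_cast hm
    set X := (2 * N : ℝ) ^ m with hX
    have hX1 : 1 ≤ X := one_le_pow₀ (by linarith)
    have hXN : (2 * N : ℝ) ^ (m + 1) * β ≤ 1 := by
      refine le_trans ?_ hs
      gcongr
      linarith
    have hXs : (2 * N : ℝ) ^ (m + 1) = 2 * N * X := by rw [pow_succ]; ring
    rw [hXs] at hXN ⊢
    have hin : ∀ i < m, |⟪a m, b i⟫| ≤ X * β := fun i hi => by
      have h1 : ⟪a m, b i⟫ = ⟪a m, a i⟫ - ⟪a m, a i - b i⟫ := by rw [inner_sub_right]; ring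
      have h2 := abs_real_inner_le_norm (a m) (a i - b i)
      rw [ha m (by omega), one_mul] at h2
      have h3 := hab m (by omega) i (by omega) (by omega)
      have h4 := hb3 i hi
      rw [h1]
      refine (abs_sub _ _).trans ?_
      linarith
    set v := a m - ∑ i ∈ Finset.range m, ⟪a m, b i⟫ • b i with hv
    have hdist : ‖a m - v‖ ≤ m * (X * β) := by
      rw [hv, sub_sub_cancel]
      refine (norm_sum_le _ _).trans ?_
      refine (Finset.sum_le_card_nsmul _ _ (X * β) fun i hi => ?_).trans ?_
      · rw [norm_smul, hb1 i (Finset.mem_range.mp hi), mul_one]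
        exact hin i (Finset.mem_range.mp hi)
      · simp
    have hXβ : 0 ≤ X * β := by positivity
    have hq : (m : ℝ) * (X * β) ≤ 1 / 2 := by nlinarith
    have hvn : |1 - ‖v‖| ≤ m * (X * β) := by
      rw [← ha m (by omega)]
      exact (abs_norm_sub_norm_le _ _).trans hdist
    have hvpos : 0 < ‖v‖ := by
      have := (abs_le.mp hvn).2
      linarith
    have horth : ∀ i < m, ⟪v, b i⟫ = 0 := fun i hi => by
      rw [hv, inner_sub_left, sum_inner, Finset.sum_eq_single i]
      · rw [real_inner_smul_left, real_inner_self_eq_norm_sq, hb1 i hi]; ring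
      · intro j hj hji
        rw [real_inner_smul_left, hb2 j (Finset.mem_range.mp hj) i hi hji, mul_zero]
      · intro h; exact absurd (Finset.mem_range.mpr hi) h
    have hbm : ‖a m - ‖v‖⁻¹ • v‖ ≤ (2 * N * X - 1) * β := by
      have h1 : a m - ‖v‖⁻¹ • v = (a m - v) + (1 - ‖v‖⁻¹) • v := by
        rw [sub_smul, one_smul]; abel
      have h2 : ‖(1 - ‖v‖⁻¹) • v‖ = |1 - ‖v‖| := by
        rw [norm_smul, Real.norm_eq_abs]
        nth_rewrite 2 [← abs_of_pos hvpos]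
        rw [← abs_mul, sub_mul, inv_mul_cancel₀ hvpos.ne', one_mul, abs_sub_comm]
      rw [h1]
      refine (norm_add_le _ _).trans ?_
      rw [h2]
      have : (2 * (m * X) : ℝ) ≤ 2 * N * X - 1 := by nlinarith
      nlinarith
    refine ⟨Function.update b m (‖v‖⁻¹ • v), ?_, ?_, ?_⟩
    · intro i hi
      rcases eq_or_ne i m with rfl | h
      · rw [Function.update_self, norm_smul, norm_inv, norm_norm, inv_mul_cancel₀ hvpos.ne']
      · rw [Function.update_of_ne h]; exact hb1 i (by omega)
    · intro i hi j hj hij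
      rcases eq_or_ne i m with rfl | h
      · rw [Function.update_self, Function.update_of_ne hij.symm, real_inner_smul_left,
          horth j (by omega), mul_zero]
      · rcases eq_or_ne j m with rfl | h'
        · rw [Function.update_self, Function.update_of_ne hij, real_inner_smul_right,
            real_inner_comm, horth i (by omega), mul_zero]
        · rw [Function.update_of_ne h, Function.update_of_ne h']
          exact hb2 i (by omega) j (by omega) hij
    · intro i hi
      rcases eq_or_ne i m with rfl | h
      · rw [Function.update_self]; exact hbm
      · rw [Function.update_of_ne h]
        refine (hb3 i (by omega)).trans ?_
        gcongr
        nlinarith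

/-- explicit rotation taking `f` to `e`. -/
def rotMap {V : Type*} [NormedAddCommGroup V] [InnerProductSpace ℝ V] (e f x : V) : V :=
  x - ((⟪e, x⟫ + ⟪f, x⟫) / (1 + ⟪e, f⟫)) • (e + f) + (2 * ⟪f, x⟫) • e

lemma rotMap_inner {V : Type*} [NormedAddCommGroup V] [InnerProductSpace ℝ V] (e f x y : V)
    (he : ‖e‖ = 1) (hf : ‖f‖ = 1) (hef : 1 + ⟪e, f⟫ ≠ 0) :
    ⟪rotMap e f x, rotMap e f y⟫ = ⟪x, y⟫ := by
  have h1 : ⟪e, e⟫ = (1 : ℝ) := by rw [real_inner_self_eq_norm_sq, he]; norm_num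
  have h2 : ⟪f, f⟫ = (1 : ℝ) := by rw [real_inner_self_eq_norm_sq, hf]; norm_num
  unfold rotMap
  simp only [inner_add_left, inner_sub_left, inner_add_right, inner_sub_right,
    real_inner_smul_left, real_inner_smul_right, h1, h2, real_inner_comm e f,
    real_inner_comm e x, real_inner_comm f x]
  have h3 : ⟪f, e⟫ = ⟪e, f⟫ := real_inner_comm _ _
  simp only [real_inner_comm] at *
  field_simp
  ring

lemma rotMap_self {V : Type*} [NormedAddCommGroup V] [InnerProductSpace ℝ V] (e f : V)
    (hf : ‖f‖ = 1) (hef : 1 + ⟪e, f⟫ ≠ 0) : rotMap e f f = e := by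
  have h2 : ⟪f, f⟫ = (1 : ℝ) := by rw [real_inner_self_eq_norm_sq, hf]; norm_num
  unfold rotMap
  rw [h2, add_comm ⟪e, f⟫ 1, div_self hef, one_smul, mul_one, two_smul]
  abel

lemma rotMap_dist {V : Type*} [NormedAddCommGroup V] [InnerProductSpace ℝ V] (e f x : V)
    (he : ‖e‖ = 1) (hf : ‖f‖ = 1) (hx : ‖x‖ = 1) (hd : ‖e - f‖ ≤ 1) :
    ‖rotMap e f x - x‖ ≤ 5 * ‖e - f‖ := by
  have h0 : ‖e - f‖ ^ 2 = 2 - 2 * ⟪e, f⟫ := by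
    rw [norm_sub_sq_real, he, hf]; ring
  set d := ‖e - f‖ with hd'
  have hd0 : 0 ≤ d := norm_nonneg _
  have hγ1 : 1 ≤ 1 + ⟪e, f⟫ := by nlinarith
  set γ := 1 + ⟪e, f⟫ with hγ
  have hγ0 : γ ≠ 0 := by linarith
  have hq := abs_real_inner_le_norm f x
  have hp := abs_real_inner_le_norm e x
  have hr := abs_real_inner_le_norm (e - f) x
  rw [hf, hx, one_mul] at hq
  rw [he, hx, one_mul] at hp
  rw [hx, mul_one, inner_sub_left] at hr
  have key : rotMap e f x - x = (- ⟪f, x⟫ * d ^ 2 / γ) • e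
      + (-(2 * (⟪e, x⟫ - ⟪f, x⟫) / γ)) • e + ((⟪e, x⟫ + ⟪f, x⟫) / γ) • (e - f) := by
    have h3 : d ^ 2 = 4 - 2 * γ := by rw [h0, hγ]; ring
    rw [h3]
    unfold rotMap
    rw [← hγ]
    have : (- ⟪f, x⟫ * (4 - 2 * γ) / γ) = 2 * ⟪f, x⟫ - 4 * ⟪f, x⟫ / γ := by
      field_simp; ring
    rw [this]
    module
  rw [key]
  have n1 : ‖(- ⟪f, x⟫ * d ^ 2 / γ) • e‖ ≤ d := by
    rw [norm_smul, he, mul_one, Real.norm_eq_abs, abs_div, abs_mul, abs_neg,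
      abs_of_pos (show 0 < γ by linarith), abs_of_nonneg (sq_nonneg d), div_le_iff₀ (by linarith)]
    nlinarith [abs_nonneg ⟪f, x⟫]
  have n2 : ‖(-(2 * (⟪e, x⟫ - ⟪f, x⟫) / γ)) • e‖ ≤ 2 * d := by
    rw [norm_smul, he, mul_one, Real.norm_eq_abs, abs_neg, abs_div, abs_mul,
      abs_of_pos (show 0 < γ by linarith), div_le_iff₀ (by linarith)]
    norm_num
    nlinarith
  have n3 : ‖((⟪e, x⟫ + ⟪f, x⟫) / γ) • (e - f)‖ ≤ 2 * d := by
    rw [norm_smul, ← hd', Real.norm_eq_abs, abs_div,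
      abs_of_pos (show 0 < γ by linarith)]
    gcongr
    rw [div_le_iff₀ (by linarith)]
    have := abs_add_le ⟪e, x⟫ ⟪f, x⟫
    linarith
  calc _ ≤ ‖(- ⟪f, x⟫ * d ^ 2 / γ) • e‖ + ‖(-(2 * (⟪e, x⟫ - ⟪f, x⟫) / γ)) • e‖
        + ‖((⟪e, x⟫ + ⟪f, x⟫) / γ) • (e - f)‖ := norm_add₃_le
    _ ≤ _ := by linarith

lemma angle_le_chord {V : Type*} [NormedAddCommGroup V] [InnerProductSpace ℝ V] (x y : V)
    (hx : ‖x‖ = 1) (hy : ‖y‖ = 1) : InnerProductGeometry.angle x y ≤ 2 * ‖x - y‖ := by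
  set θ := InnerProductGeometry.angle x y with hθ
  have h0 : 0 ≤ θ := InnerProductGeometry.angle_nonneg _ _
  have hπ : θ ≤ Real.pi := InnerProductGeometry.angle_le_pi _ _
  have h1 : ⟪x, y⟫ = Real.cos θ := by
    rw [hθ, InnerProductGeometry.cos_angle, hx, hy]; simp
  have h2 : ‖x - y‖ ^ 2 = 2 - 2 * Real.cos θ := by
    rw [norm_sub_sq_real, hx, hy, h1]; ring
  have h3 : 2 / Real.pi * (θ / 2) ≤ Real.sin (θ / 2) :=
    Real.mul_le_sin (by linarith) (by linarith)
  have h4 : Real.cos θ = 1 - 2 * Real.sin (θ / 2) ^ 2 := by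
    have := Real.cos_two_mul (θ / 2)
    rw [show 2 * (θ / 2) = θ by ring] at this
    rw [this, Real.cos_sq']; ring
  have h5 : θ / 4 ≤ 2 / Real.pi * (θ / 2) := by
    have : 2 / Real.pi * (θ / 2) = θ / Real.pi := by ring
    rw [this]
    exact div_le_div_of_nonneg_left h0 Real.pi_pos Real.pi_le_four
  have h6 : (θ / 4) ^ 2 ≤ Real.sin (θ / 2) ^ 2 := pow_le_pow_left₀ (by linarith) (by linarith) 2
  apply abs_le_of_sq_le_sq' _ (by positivity) |>.2
  nlinarith

lemma select_idx {N k : ℕ} (a : Fin k → EuclideanSpace ℝ (Fin N)) (C : Fin k → ℝ)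
    (hC : ∀ i, 0 < C i) (ha : ∀ i, ‖a i‖ = 1)
    (hI : ∀ x, ‖x‖ ^ 2 = ∑ i, C i * ⟪a i, x⟫ ^ 2) (hCN : ∑ i, C i = N)
    (η δ : ℝ) (hη : 0 < η) (hkη : k * η ≤ 1 / 4) (hδ0 : 0 ≤ δ) (hδ : N * (8 * δ) < 3 / 4)
    (h : ∀ i j, η ≤ C i → η ≤ C j → ⟪a i, a j⟫ ^ 2 * (1 - ⟪a i, a j⟫) ≤ δ) :
    ∃ idx : Fin N → Fin k, StrictMono idx ∧
      ∀ j j', j ≠ j' → ⟪a (idx j), a (idx j')⟫ ^ 2 ≤ 2 * δ := by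
  classical
  set Fam := (Finset.univ : Finset (Finset (Fin k))).filter fun J =>
    (∀ i ∈ J, η ≤ C i) ∧ ∀ i ∈ J, ∀ j ∈ J, i ≠ j → ⟪a i, a j⟫ ^ 2 ≤ 2 * δ with hFam
  obtain ⟨J, hJ, hmax⟩ := Finset.exists_max_image Fam Finset.card ⟨∅, by simp [hFam]⟩
  have hJ' := (Finset.mem_filter.mp hJ).2
  have hclose : ∀ i, η ≤ C i → ∃ j ∈ J, ‖a i - a j‖ ^ 2 ≤ 8 * δ := by
    intro i hi
    by_cases hiJ : i ∈ J
    · exact ⟨i, hiJ, by simp; linarith⟩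
    by_contra hcon
    push Not at hcon
    have hmem : insert i J ∈ Fam := by
      have hpi : ∀ j ∈ J, ⟪a i, a j⟫ ^ 2 ≤ 2 * δ := fun j hj => by
        have h1 := hcon j hj
        have h2 := h i j hi (hJ'.1 j hj)
        rw [norm_sub_sq_real, ha, ha] at h1
        have h3 := abs_real_inner_le_norm (a i) (a j)
        rw [ha, ha] at h3
        have h4 := (abs_le.mp h3)
        set p := ⟪a i, a j⟫
        have : p < 1 / 2 := by
          by_contra hp
          push Not at hp
          nlinarith [mul_nonneg (show 0 ≤ p - 1/2 by linarith) (show 0 ≤ 1 - p by linarith), mul_nonneg (mul_nonneg (show 0 ≤ p - 1/2 by linarith) (show 0 ≤ p - 1/2 by linarith)) (show 0 ≤ 1 - p by linarith)]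
        nlinarith [sq_nonneg p]
      rw [hFam, Finset.mem_filter]
      refine ⟨Finset.mem_univ _, ?_, ?_⟩
      · intro j hj
        rcases Finset.mem_insert.mp hj with rfl | hj
        · exact hi
        · exact hJ'.1 j hj
      · intro j hj j' hj' hne
        rcases Finset.mem_insert.mp hj with hji | hjJ
        · rcases Finset.mem_insert.mp hj' with hji' | hjJ'
          · exact absurd (hji.trans hji'.symm) hne
          · rw [hji]; exact hpi j' hjJ'
        · rcases Finset.mem_insert.mp hj' with hji' | hjJ'
          · rw [hji', real_inner_comm]; exact hpi j hjJ
          · exact hJ'.2 j hjJ j' hjJ' hne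
    have := hmax _ hmem
    rw [Finset.card_insert_of_notMem hiJ] at this
    omega
  have hcard : N ≤ J.card := by
    by_contra hlt
    push Not at hlt
    set W := Submodule.span ℝ ((J.image a : Finset _) : Set (EuclideanSpace ℝ (Fin N))) with hW
    have hWr : Module.finrank ℝ W < N :=
      ((finrank_span_finset_le_card _).trans Finset.card_image_le).trans_lt hlt
    have hne : Wᗮ ≠ ⊥ := by
      intro hb
      rw [Submodule.orthogonal_eq_bot_iff] at hb
      rw [hb, finrank_top] at hWr
      simp at hWr
    obtain ⟨y, hyW, hy0⟩ := Submodule.exists_mem_ne_zero_of_ne_bot hne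
    set x := ‖y‖⁻¹ • y with hx
    have hxn : ‖x‖ = 1 := by
      rw [hx, norm_smul, norm_inv, norm_norm, inv_mul_cancel₀ (norm_ne_zero_iff.mpr hy0)]
    have hxW : x ∈ Wᗮ := Submodule.smul_mem _ _ hyW
    have hxJ : ∀ j ∈ J, ⟪a j, x⟫ = 0 := fun j hj =>
      (Submodule.mem_orthogonal _ _).mp hxW _
        (Submodule.subset_span (by simpa using ⟨j, hj, rfl⟩))
    have hterm : ∀ i, C i * ⟪a i, x⟫ ^ 2 ≤ η + C i * (8 * δ) := by
      intro i
      have hCi := hC i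
      rcases le_total η (C i) with hi | hi
      · obtain ⟨j, hj, hij⟩ := hclose i hi
        have h1 : ⟪a i, x⟫ = ⟪a i - a j, x⟫ := by rw [inner_sub_left, hxJ j hj, sub_zero]
        have h2 := abs_real_inner_le_norm (a i - a j) x
        rw [hxn, mul_one] at h2
        have h3 : ⟪a i, x⟫ ^ 2 ≤ 8 * δ := by
          rw [h1, ← sq_abs]
          exact (pow_le_pow_left₀ (abs_nonneg _) h2 2).trans hij
        nlinarith
      · have h2 := abs_real_inner_le_norm (a i) x
        rw [hxn, ha, mul_one] at h2
        have h3 : ⟪a i, x⟫ ^ 2 ≤ 1 := by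
          rw [← sq_abs]; exact pow_le_one₀ (abs_nonneg _) h2
        nlinarith
    have hsum := Finset.sum_le_sum (s := Finset.univ) fun i _ => hterm i
    rw [← hI, hxn, Finset.sum_add_distrib, ← Finset.sum_mul, hCN] at hsum
    simp at hsum
    linarith
  obtain ⟨J', hJ'sub, hJ'card⟩ := Finset.exists_subset_card_eq hcard
  refine ⟨J'.orderEmbOfFin hJ'card, (J'.orderEmbOfFin hJ'card).strictMono, ?_⟩
  intro j j' hne
  exact hJ'.2 _ (hJ'sub (Finset.orderEmbOfFin_mem _ _ _)) _
    (hJ'sub (Finset.orderEmbOfFin_mem _ _ _))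
    (fun hh => hne ((J'.orderEmbOfFin hJ'card).injective hh))


lemma simplex_close (n : ℕ) (hn : 1 ≤ n) (e : EuclideanSpace ℝ (Fin (n + 1))) (he : ‖e‖ = 1)
    (u a : Fin (n + 1) → EuclideanSpace ℝ (Fin (n + 1)))
    (hua : ∀ j, a j = Real.sqrt ((n : ℝ) / (n + 1)) • u j + (Real.sqrt (n + 1))⁻¹ • e)
    (ha : ∀ j, ‖a j‖ = 1) (hae : ∀ j, ⟪a j, e⟫ = (Real.sqrt (n + 1))⁻¹)
    (β : ℝ) (hβ : 0 ≤ β) (hab : ∀ i j, i ≠ j → |⟪a i, a j⟫| ≤ β)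
    (T : ℝ) (hT : T = (2 * ((n : ℝ) + 1)) ^ (n + 1) * β) (hTs : (n + 1) * T ^ 2 ≤ 1) :
    ∃ w : Fin (n + 1) → EuclideanSpace ℝ (Fin (n + 1)),
      (∀ j, ‖w j‖ = 1) ∧ (∀ j, ⟪w j, e⟫ = 0) ∧
      (∀ j j', j ≠ j' → ⟪w j, w j'⟫ = -1 / n) ∧
      ∀ j, ‖u j - w j‖ ≤ Real.sqrt (((n : ℝ) + 1) / n) * (6 * Real.sqrt (n + 1) * T) := by
  have hn0 : (0 : ℝ) < n := by exact_mod_cast hn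
  set N : ℝ := (n : ℝ) + 1 with hN
  have hN0 : 0 < N := by positivity
  have hN1 : 1 ≤ N := by linarith
  have hsN : 0 < Real.sqrt N := Real.sqrt_pos.mpr hN0
  have hsN1 : 1 ≤ Real.sqrt N := Real.one_le_sqrt.mpr hN1
  have hsq : Real.sqrt N * Real.sqrt N = N := Real.mul_self_sqrt hN0.le
  have hT0 : 0 ≤ T := by rw [hT]; positivity
  have hT1 : T ≤ 1 := by nlinarith
  set r := (Real.sqrt N)⁻¹ with hr
  have hr0 : 0 < r := inv_pos.mpr hsN
  have hrr : r * r = 1 / N := by rw [hr, ← mul_inv, hsq, one_div]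
  have hrN : r * N = Real.sqrt N := by rw [hr]; nth_rewrite 2 [← hsq]; field_simp
  -- Gram-Schmidt
  have hcast : (((n + 1 : ℕ) : ℝ)) = N := by push_cast; rfl
  obtain ⟨b', hb1', hb2', hb3'⟩ := gs_close (n + 1) (by omega)
    (fun i => if h : i < n + 1 then a ⟨i, h⟩ else 0) β hβ (by rw [hcast, ← hT]; exact hT1)
    (fun i hi => by simp only [hi, dif_pos]; exact ha _)
    (fun i hi j hj hij => by
      simp only [hi, hj, dif_pos]; exact hab _ _ (by simpa [Fin.ext_iff] using hij))
    (n + 1) le_rfl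
  set b : Fin (n + 1) → EuclideanSpace ℝ (Fin (n + 1)) := fun j => b' j with hb
  have hb1 : ∀ j, ‖b j‖ = 1 := fun j => hb1' j j.2
  have hb2 : ∀ i j, i ≠ j → ⟪b i, b j⟫ = 0 := fun i j hij =>
    hb2' i i.2 j j.2 (fun h => hij (Fin.ext h))
  have hb3 : ∀ j, ‖a j - b j‖ ≤ T := fun j => by
    have := hb3' j j.2
    simp only [j.2, dif_pos] at this
    refine this.trans ?_
    rw [hT, hcast]
    nlinarith
  have hon : Orthonormal ℝ b := ⟨hb1, fun i j hij => hb2 i j hij⟩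
  have hspan : ⊤ ≤ Submodule.span ℝ (Set.range b) := by
    rw [hon.linearIndependent.span_eq_top_of_card_eq_finrank' (by simp)]
  set B := OrthonormalBasis.mk hon hspan with hB
  have hBb : ∀ j, B j = b j := fun j => by rw [hB, OrthonormalBasis.coe_mk]
  set f := r • ∑ j, b j with hf
  have hbf : ∀ j, ⟪b j, f⟫ = r := fun j => by
    rw [hf, real_inner_smul_right, inner_sum, Finset.sum_eq_single j]
    · rw [real_inner_self_eq_norm_sq, hb1]; ring
    · intro i _ hij; exact hb2 j i hij.symm
    · simp
  have hff : ‖f‖ = 1 := by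
    have h1 : ‖f‖ ^ 2 = 1 := by
      rw [← real_inner_self_eq_norm_sq]
      nth_rewrite 1 [hf]
      rw [real_inner_smul_left, sum_inner]
      simp only [hbf]
      simp only [Finset.sum_const, Finset.card_univ, Fintype.card_fin, nsmul_eq_mul, hcast]
      rw [mul_comm N r, ← mul_assoc, hrr]; field_simp
    exact (pow_eq_one_iff_of_nonneg (norm_nonneg _) two_ne_zero).mp h1
  have hd : ‖e - f‖ ≤ Real.sqrt N * T := by
    apply abs_le_of_sq_le_sq' _ (by positivity) |>.2
    have h1 := B.sum_sq_norm_inner_right (e - f)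
    rw [← h1, mul_pow, Real.sq_sqrt hN0.le]
    have h2 : ∀ j ∈ (Finset.univ : Finset (Fin (n + 1))), ‖⟪B j, e - f⟫‖ ^ 2 ≤ T ^ 2 := by
      intro j _
      refine pow_le_pow_left₀ (norm_nonneg _) ?_ 2
      have h3 : ⟪B j, e - f⟫ = - ⟪a j - b j, e⟫ := by
        rw [hBb, inner_sub_right, hbf, inner_sub_left, hae]; ring
      rw [h3, norm_neg]
      have h4 := norm_inner_le_norm (𝕜 := ℝ) (a j - b j) e
      rw [he, mul_one] at h4
      exact h4.trans (hb3 j)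
    have h5 := Finset.sum_le_card_nsmul _ _ _ h2
    simpa [hN] using h5
  have hd1 : Real.sqrt N * T ≤ 1 := by
    apply abs_le_of_sq_le_sq' _ (by positivity) |>.2
    rw [mul_pow, Real.sq_sqrt hN0.le]; simpa using hTs
  have hef : 1 + ⟪e, f⟫ ≠ 0 := by
    have h0 : ‖e - f‖ ^ 2 = 2 - 2 * ⟪e, f⟫ := by
      rw [norm_sub_sq_real, he, hff]; ring
    have : ‖e - f‖ ^ 2 ≤ 1 := pow_le_one₀ (norm_nonneg _) (hd.trans hd1)
    intro h
    linarith
  set R := rotMap e f with hR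
  have hRi : ∀ x y, ⟪R x, R y⟫ = ⟪x, y⟫ := fun x y => rotMap_inner e f x y he hff hef
  have hRf : R f = e := rotMap_self e f hff hef
  have hRe : ∀ j, ⟪R (b j), e⟫ = r := fun j => by
    nth_rewrite 1 [← hRf]; rw [hRi, hbf]
  have hee : ⟪e, e⟫ = (1 : ℝ) := by rw [real_inner_self_eq_norm_sq, he]; norm_num
  set q := Real.sqrt (N / n) with hq
  have hqq : q * q = N / n := Real.mul_self_sqrt (by positivity)
  have hww : ∀ i j, ⟪q • (R (b i) - r • e), q • (R (b j) - r • e)⟫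
      = N / n * (⟪b i, b j⟫ - 1 / N) := fun i j => by
    rw [real_inner_smul_left, real_inner_smul_right, inner_sub_left, inner_sub_right,
      inner_sub_right, hRi, real_inner_smul_right, real_inner_smul_left, real_inner_smul_left,
      real_inner_smul_right, hRe, real_inner_comm (R (b j)) e, hRe, hee, ← mul_assoc, hqq, ← hrr]
    ring
  refine ⟨fun j => q • (R (b j) - r • e), ?_, ?_, ?_, ?_⟩
  · intro j
    have h1 := hww j j
    rw [real_inner_self_eq_norm_sq, real_inner_self_eq_norm_sq, hb1] at h1
    refine (pow_eq_one_iff_of_nonneg (norm_nonneg _) two_ne_zero).mp ?_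
    rw [h1]; field_simp; rw [hN]; ring
  · intro j
    simp only
    rw [real_inner_smul_left, inner_sub_left, real_inner_smul_left, hRe, hee]; ring
  · intro i j hij
    simp only
    rw [hww, hb2 i j hij]; field_simp; ring
  · intro j
    have h1 : u j = q • (a j - r • e) := by
      rw [hua j, add_sub_cancel_right, smul_smul]
      have : q * Real.sqrt (n / N) = 1 := by
        rw [hq, ← Real.sqrt_mul (by positivity)]
        rw [show N / n * (n / N) = 1 by field_simp, Real.sqrt_one]
      rw [this, one_smul]
    have h2 : u j - q • (R (b j) - r • e) = q • ((a j - b j) - (R (b j) - b j)) := by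
      rw [h1, ← smul_sub]; congr 1; abel
    simp only
    rw [h2, norm_smul, Real.norm_eq_abs, abs_of_nonneg (Real.sqrt_nonneg _)]
    refine mul_le_mul_of_nonneg_left ?_ (Real.sqrt_nonneg _)
    have h3 := rotMap_dist e f (b j) he hff (hb1 j) (hd.trans hd1)
    have h4 := norm_sub_le (a j - b j) (R (b j) - b j)
    have h5 := hb3 j
    nlinarith

lemma setup_sum (n k : ℕ) (e : EuclideanSpace ℝ (Fin (n + 1))) (he : ‖e‖ = 1)
    (u : Fin k → EuclideanSpace ℝ (Fin (n + 1)))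
    (hu : ∀ i, ‖u i‖ = 1) (hue : ∀ i, ⟪u i, e⟫ = 0) (c : Fin k → ℝ)
    (hiso : ∀ x : EuclideanSpace ℝ (Fin (n + 1)),
      ⟪x, e⟫ = 0 → ‖x‖ ^ 2 = ∑ i, c i * ⟪u i, x⟫ ^ 2) : ∑ i, c i = n := by
  set b := EuclideanSpace.basisFun (Fin (n + 1)) ℝ
  have hee : ⟪e, e⟫ = (1 : ℝ) := by rw [real_inner_self_eq_norm_sq, he]; norm_num
  have h1 : ∀ m, (1 : ℝ) - ⟪b m, e⟫ ^ 2 = ∑ i, c i * ⟪u i, b m⟫ ^ 2 := fun m => by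
    have h2 := hiso (b m - ⟪b m, e⟫ • e) (by
      rw [inner_sub_left, real_inner_smul_left, hee]; ring)
    rw [norm_sub_sq_real, real_inner_smul_right, norm_smul, he, b.norm_eq_one] at h2
    simp only [inner_sub_right, real_inner_smul_right, hue, mul_zero, sub_zero] at h2
    rw [← h2, mul_one, Real.norm_eq_abs, sq_abs]; ring
  have h3 : ∀ v : EuclideanSpace ℝ (Fin (n + 1)), ∑ m, ⟪v, b m⟫ ^ 2 = ‖v‖ ^ 2 := fun v => by
    rw [← b.sum_sq_norm_inner_left v]
    simp [sq_abs]
  have h4 := Finset.sum_congr (s₁ := Finset.univ) rfl fun m _ => h1 m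
  rw [Finset.sum_comm] at h4
  simp only [← Finset.mul_sum, h3, hu, Finset.sum_sub_distrib] at h4
  have h5 : ∑ m, ⟪b m, e⟫ ^ 2 = 1 := by
    have := h3 e
    rw [he] at this
    simpa [real_inner_comm] using this
  rw [h5] at h4
  simp at h4
  linarith

lemma setup_iso (n k : ℕ) (hn : 1 ≤ n) (e : EuclideanSpace ℝ (Fin (n + 1))) (he : ‖e‖ = 1)
    (u : Fin k → EuclideanSpace ℝ (Fin (n + 1)))
    (hu : ∀ i, ‖u i‖ = 1) (hue : ∀ i, ⟪u i, e⟫ = 0) (c : Fin k → ℝ)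
    (hiso : ∀ x : EuclideanSpace ℝ (Fin (n + 1)),
      ⟪x, e⟫ = 0 → ‖x‖ ^ 2 = ∑ i, c i * ⟪u i, x⟫ ^ 2)
    (hcent : ∑ i, c i • u i = 0)
    (ut : Fin k → EuclideanSpace ℝ (Fin (n + 1)))
    (hut : ∀ i, ut i = Real.sqrt ((n : ℝ) / (n + 1)) • u i + (Real.sqrt (n + 1))⁻¹ • e)
    (ct : Fin k → ℝ) (hct : ∀ i, ct i = ((n : ℝ) + 1) / n * c i) :
    (∀ i, ‖ut i‖ = 1) ∧ (∀ i, ⟪ut i, e⟫ = (Real.sqrt (n + 1))⁻¹) ∧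
    (∑ i, ct i = ((n + 1 : ℕ) : ℝ)) ∧ (∀ x, ‖x‖ ^ 2 = ∑ i, ct i * ⟪ut i, x⟫ ^ 2) := by
  have hn0 : (0 : ℝ) < n := by exact_mod_cast hn
  have hee : ⟪e, e⟫ = (1 : ℝ) := by rw [real_inner_self_eq_norm_sq, he]; norm_num
  set A := Real.sqrt ((n : ℝ) / (n + 1)) with hA
  set r := (Real.sqrt ((n : ℝ) + 1))⁻¹ with hr
  have hAA : A ^ 2 = n / (n + 1) := Real.sq_sqrt (by positivity)
  have hrr : r ^ 2 = 1 / (n + 1) := by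
    rw [hr, inv_pow, Real.sq_sqrt (by positivity), one_div]
  have hsum := setup_sum n k e he u hu hue c hiso
  refine ⟨?_, ?_, ?_, ?_⟩
  · intro i
    refine (pow_eq_one_iff_of_nonneg (norm_nonneg _) two_ne_zero).mp ?_
    rw [hut, norm_add_sq_real, norm_smul, norm_smul, real_inner_smul_left, real_inner_smul_right,
      hue, he, hu, mul_one, mul_one, Real.norm_eq_abs, Real.norm_eq_abs, sq_abs, sq_abs, hAA, hrr]
    field_simp; ring
  · intro i
    rw [hut, inner_add_left, real_inner_smul_left, real_inner_smul_left, hue, hee]; ring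
  · simp only [hct]
    rw [← Finset.mul_sum, hsum]; push_cast; field_simp
  · intro x
    set t := ⟪e, x⟫ with ht
    set y := x - t • e with hy
    have hye : ⟪y, e⟫ = 0 := by
      rw [hy, inner_sub_left, real_inner_smul_left, hee, real_inner_comm]; ring
    have h1 := hiso y hye
    have h2 : ‖x‖ ^ 2 = ‖y‖ ^ 2 + t ^ 2 := by
      rw [hy, norm_sub_sq_real, real_inner_smul_right, norm_smul, he, real_inner_comm, ← ht,
        mul_one, Real.norm_eq_abs, sq_abs]; ring
    have h3 : ∀ i, ⟪u i, y⟫ = ⟪u i, x⟫ := fun i => by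
      rw [hy, inner_sub_right, real_inner_smul_right, hue]; ring
    have h4 : ∑ i, c i * ⟪u i, x⟫ = 0 := by
      have := congrArg (fun v => ⟪v, x⟫) hcent
      simpa [sum_inner, real_inner_smul_left] using this
    simp only [h3] at h1
    rw [h2, h1]
    have h5 : ∀ i, ct i * ⟪ut i, x⟫ ^ 2 = ((n : ℝ) + 1) / n * (A ^ 2 * (c i * ⟪u i, x⟫ ^ 2)
        + 2 * A * r * t * (c i * ⟪u i, x⟫) + r ^ 2 * t ^ 2 * c i) := fun i => by
      rw [hct, hut, inner_add_left, real_inner_smul_left, real_inner_smul_left, ← ht]; ring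
    simp only [h5]
    rw [← Finset.mul_sum, Finset.sum_add_distrib, Finset.sum_add_distrib, ← Finset.mul_sum,
      ← Finset.mul_sum, ← Finset.mul_sum, h4, hsum, hAA, hrr]
    field_simp; ring

lemma const_bound (n : ℕ) (hn : 2 ≤ n) :
    144 * ((n : ℝ) + 1) ^ 2 / n * ((2 * ((n : ℝ) + 1)) ^ (n + 1)) ^ 2 *
      (2 ^ 36 * (640 * ((n : ℝ) + 1)) ^ (n + 1)) * (8 * (n : ℝ) ^ 2) ^ 2 ≤ (n : ℝ) ^ (56 * n) := by
  have h2 : (2 : ℝ) ≤ n := by exact_mod_cast hn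
  have h0 : (0 : ℝ) < n := by linarith
  have hp : ∀ m : ℕ, (2 : ℝ) ^ m ≤ (n : ℝ) ^ m := fun m => pow_le_pow_left₀ (by norm_num) h2 m
  have hN : (n : ℝ) + 1 ≤ (n : ℝ) ^ 2 := by nlinarith
  have e1 : 144 * ((n : ℝ) + 1) ^ 2 / n ≤ (n : ℝ) ^ 12 := by
    rw [div_le_iff₀ h0]
    calc 144 * ((n : ℝ) + 1) ^ 2 ≤ 2 ^ 9 * ((n : ℝ) ^ 2) ^ 2 := by gcongr; norm_num
      _ ≤ (n : ℝ) ^ 9 * ((n : ℝ) ^ 2) ^ 2 := by gcongr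
      _ = _ := by ring
  have e2 : ((2 * ((n : ℝ) + 1)) ^ (n + 1)) ^ 2 ≤ (n : ℝ) ^ (6 * (n + 1)) := by
    calc ((2 * ((n : ℝ) + 1)) ^ (n + 1)) ^ 2 ≤ ((n * (n : ℝ) ^ 2) ^ (n + 1)) ^ 2 := by gcongr
      _ = _ := by rw [← pow_succ', ← pow_mul, ← pow_mul]; congr 1; ring
  have e3 : (640 * ((n : ℝ) + 1)) ^ (n + 1) ≤ (n : ℝ) ^ (12 * (n + 1)) := by
    calc (640 * ((n : ℝ) + 1)) ^ (n + 1) ≤ (2 ^ 10 * (n : ℝ) ^ 2) ^ (n + 1) := by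
          gcongr; norm_num
      _ ≤ ((n : ℝ) ^ 10 * (n : ℝ) ^ 2) ^ (n + 1) := by gcongr
      _ = _ := by rw [← pow_add, ← pow_mul]
  have e4 : (8 * (n : ℝ) ^ 2) ^ 2 ≤ (n : ℝ) ^ 10 := by
    calc (8 * (n : ℝ) ^ 2) ^ 2 = 2 ^ 6 * (n : ℝ) ^ 4 := by ring
      _ ≤ (n : ℝ) ^ 6 * (n : ℝ) ^ 4 := by gcongr
      _ = _ := by ring
  calc _ ≤ (n : ℝ) ^ 12 * (n : ℝ) ^ (6 * (n + 1)) * ((n : ℝ) ^ 36 * (n : ℝ) ^ (12 * (n + 1)))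
        * (n : ℝ) ^ 10 := by gcongr
    _ = (n : ℝ) ^ (18 * n + 76) := by
        simp only [← pow_add]; congr 1; ring
    _ ≤ _ := pow_le_pow_right₀ (by linarith) (by omega)


lemma main_one (k : ℕ) (hk₁ : 1 + 1 ≤ k) (hk₂ : k ≤ 2 * 1 ^ 2)
    (e : EuclideanSpace ℝ (Fin (1 + 1)))
    (u : Fin k → EuclideanSpace ℝ (Fin (1 + 1)))
    (hu : ∀ i, ‖u i‖ = 1) (hue : ∀ i, ⟪u i, e⟫ = 0)
    (c : Fin k → ℝ) (hc : ∀ i, 0 < c i) (hcent : ∑ i, c i • u i = 0)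
    (ε : ℝ) (hε0 : 0 < ε) :
    ∃ w : Fin (1 + 1) → EuclideanSpace ℝ (Fin (1 + 1)),
      (∀ j, ‖w j‖ = 1) ∧ (∀ j, ⟪w j, e⟫ = 0) ∧
      (∀ j j', j ≠ j' → ⟪w j, w j'⟫ = -1 / ((1 : ℕ) : ℝ)) ∧
      ∃ idx : Fin (1 + 1) → Fin k, StrictMono idx ∧
        ∀ j, InnerProductGeometry.angle (u (idx j)) (w j) <
          ((1 : ℕ) : ℝ) ^ (14 * 1) * ε ^ ((1 : ℝ) / 4) := by
  obtain rfl : k = 1 + 1 := by omega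
  have h01 : ⟪u 0, u 1⟫ = -1 := by
    have h1 : c 0 • u 0 + c 1 • u 1 = 0 := by
      have := hcent
      rwa [Fin.sum_univ_two] at this
    have i1 := congrArg (fun v => ⟪v, u 0⟫) h1
    have i2 := congrArg (fun v => ⟪v, u 1⟫) h1
    simp only [inner_add_left, real_inner_smul_left, real_inner_self_eq_norm_sq, hu,
      inner_zero_left] at i1 i2
    rw [real_inner_comm] at i1
    have c0 := hc 0
    have c1 := hc 1
    set p := ⟪u 0, u 1⟫
    have h2 : (c 0 - c 1) * (1 - p) = 0 := by linarith
    have h3 : p ≠ 1 := fun hp => by rw [hp] at i1; linarith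
    have h4 : c 0 - c 1 = 0 := by
      rcases mul_eq_zero.mp h2 with h | h
      · exact h
      · exact absurd (by linarith) h3
    have h5 : c 0 * (1 + p) = 0 := by
      have : c 1 = c 0 := by linarith
      rw [this] at i1; linarith
    rcases mul_eq_zero.mp h5 with h | h
    · exact absurd h c0.ne'
    · linarith
  refine ⟨u, hu, hue, ?_, id, strictMono_id, ?_⟩
  · intro j j' hjj
    fin_cases j <;> fin_cases j' <;> simp at hjj ⊢
    · exact h01
    · rw [real_inner_comm]; exact h01
  · intro j
    have : u j ≠ 0 := fun h => by have := hu j; rw [h] at this; simp at this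
    rw [id, InnerProductGeometry.angle_self this]
    have := Real.rpow_pos_of_pos hε0 (1 / 4)
    simpa using this

set_option maxHeartbeats 2000000 in
lemma main_two (n k : ℕ) (hn : 2 ≤ n) (hk₂ : k ≤ 2 * n ^ 2)
    (e : EuclideanSpace ℝ (Fin (n + 1))) (he : ‖e‖ = 1)
    (u : Fin k → EuclideanSpace ℝ (Fin (n + 1)))
    (hu : ∀ i, ‖u i‖ = 1) (hue : ∀ i, ⟪u i, e⟫ = 0)
    (c : Fin k → ℝ) (hc : ∀ i, 0 < c i)
    (hiso : ∀ x : EuclideanSpace ℝ (Fin (n + 1)),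
      ⟪x, e⟫ = 0 → ‖x‖ ^ 2 = ∑ i, c i * ⟪u i, x⟫ ^ 2)
    (hcent : ∑ i, c i • u i = 0)
    (s ε : ℝ) (hs : s ∈ Icc (0 : ℝ) 0.15)
    (hε0 : 0 < ε) (hε1 : ε < ((n : ℝ) ^ (56 * n))⁻¹)
    (ut : Fin k → EuclideanSpace ℝ (Fin (n + 1)))
    (hut : ∀ i, ut i = Real.sqrt ((n : ℝ) / (n + 1)) • u i + (Real.sqrt (n + 1))⁻¹ • e)
    (ct : Fin k → ℝ) (hct : ∀ i, ct i = ((n : ℝ) + 1) / n * c i)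
    (hyp :
      (1 - ε ≤ ∫ x, ∏ i, truncGauss s ⟪x, ut i⟫ ^ ct i) ∨
      upperIntegral volume
          (fun x => ⨆ (θ : Fin k → ℝ) (_ : x = ∑ i, (ct i * θ i) • ut i),
            ENNReal.ofReal (∏ i, truncGauss s (θ i) ^ ct i)) ≤
        ENNReal.ofReal (1 + ε)) :
    ∃ w : Fin (n + 1) → EuclideanSpace ℝ (Fin (n + 1)),
      (∀ j, ‖w j‖ = 1) ∧ (∀ j, ⟪w j, e⟫ = 0) ∧
      (∀ j j', j ≠ j' → ⟪w j, w j'⟫ = -1 / n) ∧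
      ∃ idx : Fin (n + 1) → Fin k, StrictMono idx ∧
        ∀ j, InnerProductGeometry.angle (u (idx j)) (w j) <
          (n : ℝ) ^ (14 * n) * ε ^ ((1 : ℝ) / 4) := by
  obtain ⟨ha, hae, hCN, hI⟩ := setup_iso n k (by omega) e he u hu hue c hiso hcent ut hut ct hct
  have h2 : (2 : ℝ) ≤ n := by exact_mod_cast hn
  have hn0 : (0 : ℝ) < n := by linarith
  have hC : ∀ i, 0 < ct i := fun i => by rw [hct]; have := hc i; positivity
  have hpow : (1 : ℝ) ≤ (n : ℝ) ^ (56 * n) := one_le_pow₀ (by linarith)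
  have hnε : (n : ℝ) ^ (56 * n) * ε < 1 := by
    have := mul_lt_mul_of_pos_left hε1 (show (0 : ℝ) < (n : ℝ) ^ (56 * n) by linarith)
    rwa [mul_inv_cancel₀ (by linarith)] at this
  have hε1' : ε < 1 := by nlinarith
  set N : ℝ := (n : ℝ) + 1 with hN
  have hN0 : 0 < N := by linarith
  have hcast : (((n + 1 : ℕ) : ℝ)) = N := by push_cast; rfl
  set K : ℝ := 2 ^ 36 * (640 * N) ^ (n + 1) with hK
  have hK0 : 0 < K := by positivity
  have hx0 : ∀ α : ℝ, ∀ i, ⟪ut i, (α * Real.sqrt N) • e⟫ = α := fun α i => by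
    have hsN : Real.sqrt N ≠ 0 := (Real.sqrt_pos.mpr hN0).ne'
    rw [real_inner_smul_right, hae]; field_simp
  have hpair : ∀ i j, ct i * ct j * ⟪ut i, ut j⟫ ^ 2 * ‖ut i - ut j‖ ^ 2 ≤ K * ε := by
    intro i j
    rw [hK, ← hcast]
    rcases hyp with h | h
    · exact case_fwd (by omega) ut ct hC ha hI hCN s hs.1 hs.2 ε hε0 hε1' _ (hx0 (3 / 32)) h i j
    · exact case_rev (by omega) ut ct hC ha hI hCN s hs.1 hs.2 ε hε0 _ (hx0 (-3 / 4)) h i j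
  set S : ℝ := (8 * (n : ℝ) ^ 2) with hS
  have hS0 : 0 < S := by positivity
  set β : ℝ := Real.sqrt (K * ε) * S with hβ
  have hβ0 : 0 ≤ β := by positivity
  have hββ : β ^ 2 = K * ε * S ^ 2 := by
    rw [hβ, mul_pow, Real.sq_sqrt (by positivity)]
  set G : ℝ := (2 * N) ^ (n + 1) with hG
  have hG1 : 1 ≤ G := one_le_pow₀ (by linarith)
  set T : ℝ := G * β with hT
  have hTT : T ^ 2 = G ^ 2 * K * S ^ 2 * ε := by rw [hT, mul_pow, hββ]; ring
  have hcb : 144 * N ^ 2 / n * T ^ 2 ≤ (n : ℝ) ^ (56 * n) * ε := by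
    have := mul_le_mul_of_nonneg_right (const_bound n hn) hε0.le
    refine le_trans (le_of_eq ?_) this
    rw [hTT]; ring
  have hNT : 144 * N * T ^ 2 ≤ 1 := by
    refine le_trans ?_ (hcb.trans hnε.le)
    refine mul_le_mul_of_nonneg_right ?_ (sq_nonneg T)
    rw [le_div_iff₀ hn0]; nlinarith
  have hβT : β ^ 2 ≤ T ^ 2 := by
    rw [hT, mul_pow]
    have : 1 ≤ G ^ 2 := one_le_pow₀ hG1
    nlinarith [sq_nonneg β]
  obtain ⟨idx, hidx, hsel⟩ := select_idx ut ct hC ha hI hCN (1 / S) (β ^ 2 / 2) (by positivity)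
    (by
      have : (k : ℝ) ≤ 2 * (n : ℝ) ^ 2 := by exact_mod_cast hk₂
      rw [mul_one_div, div_le_iff₀ hS0, hS]; linarith)
    (by positivity) (by rw [hcast]; nlinarith)
    (fun i j hi hj => by
      have h1 := hpair i j
      rw [norm_sub_sq_real, ha, ha] at h1
      have h3 := abs_real_inner_le_norm (ut i) (ut j)
      rw [ha, ha] at h3
      have h4 := (abs_le.mp h3)
      set p := ⟪ut i, ut j⟫
      have h5 : (1 / S) * (1 / S) ≤ ct i * ct j :=
        mul_le_mul hi hj (by positivity) (hC i).le
      have h6 : 0 ≤ p ^ 2 * (1 - p) := mul_nonneg (sq_nonneg _) (by linarith)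
      have h7 := mul_le_mul_of_nonneg_right h5 h6
      have h8 : (1 / S) * (1 / S) * (p ^ 2 * (1 - p)) ≤ K * ε / 2 := by linarith
      have h9 : p ^ 2 * (1 - p) = S ^ 2 * ((1 / S) * (1 / S) * (p ^ 2 * (1 - p))) := by
        field_simp
      rw [h9, hββ]
      have := mul_le_mul_of_nonneg_left h8 (sq_nonneg S)
      linarith)
  obtain ⟨w, hw1, hw2, hw3, hw4⟩ := simplex_close n (by omega) e he (fun j => u (idx j))
    (fun j => ut (idx j)) (fun j => hut _) (fun j => ha _) (fun j => hae _) β hβ0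
    (fun i j hij => by
      apply abs_le_of_sq_le_sq _ hβ0
      have := hsel i j hij
      linarith) T hT (by nlinarith)
  refine ⟨w, hw1, hw2, hw3, idx, hidx, fun j => ?_⟩
  set Y := (n : ℝ) ^ (14 * n) * ε ^ ((1 : ℝ) / 4) with hY
  have hY0 : 0 < Y := by
    have := Real.rpow_pos_of_pos hε0 (1 / 4)
    positivity
  have hY4 : Y ^ 4 = (n : ℝ) ^ (56 * n) * ε := by
    rw [hY, mul_pow, ← pow_mul, ← Real.rpow_natCast (ε ^ ((1 : ℝ) / 4)), ← Real.rpow_mul hε0.le]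
    rw [show (1 : ℝ) / 4 * ((4 : ℕ) : ℝ) = 1 by norm_num, Real.rpow_one,
      show 14 * n * 4 = 56 * n by ring]
  have hYlt : Y ^ 2 < 1 := by
    by_contra h
    push Not at h
    nlinarith
  have h3 := (angle_le_chord _ _ (hu (idx j)) (hw1 j)).trans
    (mul_le_mul_of_nonneg_left (hw4 j) (by norm_num : (0 : ℝ) ≤ 2))
  refine lt_of_le_of_lt h3 ?_
  apply lt_of_pow_lt_pow_left₀ 2 hY0.le
  have h4 : (2 * (Real.sqrt (N / n) * (6 * Real.sqrt N * T))) ^ 2 = 144 * N ^ 2 / n * T ^ 2 := by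
    simp only [mul_pow]
    rw [Real.sq_sqrt (by positivity), Real.sq_sqrt hN0.le]; ring
  rw [h4]
  refine lt_of_le_of_lt hcb ?_
  rw [← hY4]
  have : 0 < Y ^ 2 := by positivity
  nlinarith

theorem brascamp_lieb_truncated_gaussian_stability
    (n k : ℕ) (hn : 1 ≤ n) (hk₁ : n + 1 ≤ k) (hk₂ : k ≤ 2 * n ^ 2)
    (e : EuclideanSpace ℝ (Fin (n + 1))) (he : ‖e‖ = 1)
    (u : Fin k → EuclideanSpace ℝ (Fin (n + 1)))
    (hu : ∀ i, ‖u i‖ = 1) (hue : ∀ i, ⟪u i, e⟫ = 0)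
    (c : Fin k → ℝ) (hc : ∀ i, 0 < c i)
    (hiso : ∀ x : EuclideanSpace ℝ (Fin (n + 1)),
      ⟪x, e⟫ = 0 → ‖x‖ ^ 2 = ∑ i, c i * ⟪u i, x⟫ ^ 2)
    (hcent : ∑ i, c i • u i = 0)
    (s ε : ℝ) (hs : s ∈ Icc (0 : ℝ) 0.15)
    (hε0 : 0 < ε) (hε1 : ε < ((n : ℝ) ^ (56 * n))⁻¹)
    (ut : Fin k → EuclideanSpace ℝ (Fin (n + 1)))
    (hut : ∀ i, ut i = Real.sqrt ((n : ℝ) / (n + 1)) • u i + (Real.sqrt (n + 1))⁻¹ • e)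
    (ct : Fin k → ℝ) (hct : ∀ i, ct i = ((n : ℝ) + 1) / n * c i)
    (hyp :
      (1 - ε ≤ ∫ x, ∏ i, truncGauss s ⟪x, ut i⟫ ^ ct i) ∨
      upperIntegral volume
          (fun x => ⨆ (θ : Fin k → ℝ) (_ : x = ∑ i, (ct i * θ i) • ut i),
            ENNReal.ofReal (∏ i, truncGauss s (θ i) ^ ct i)) ≤
        ENNReal.ofReal (1 + ε)) :
    ∃ w : Fin (n + 1) → EuclideanSpace ℝ (Fin (n + 1)),
      (∀ j, ‖w j‖ = 1) ∧ (∀ j, ⟪w j, e⟫ = 0) ∧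
      (∀ j j', j ≠ j' → ⟪w j, w j'⟫ = -1 / n) ∧
      ∃ idx : Fin (n + 1) → Fin k, StrictMono idx ∧
        ∀ j, InnerProductGeometry.angle (u (idx j)) (w j) <
          (n : ℝ) ^ (14 * n) * ε ^ ((1 : ℝ) / 4) := by
  rcases Nat.lt_or_ge n 2 with h | h
  · obtain rfl : n = 1 := by omega
    exact main_one k hk₁ hk₂ e u hu hue c hc hcent ε hε0
  · exact main_two n k h hk₂ e he u hu hue c hc hiso hcent s ε hs hε0 hε1 ut hut ct hct hyp

end
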